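/- arXiv:1208.2635 — 3 statements merged into one kernel-verified Lean document; each statement's English description precedes it below -/
import Mathlib

section
/- Let λ = (62 + 12c)·log p for some c > 0. Then with probability at least 1 − p^(−c) over the Gaussian noise z, every subset Ĵ ⊆ {1,…,p} with Π(Ĵ) ≥ Π(J⋆) satisfies ‖X β̂_Ĵ − X β⋆‖₂ ≤ σ·√(8 s⋆ λ); in particular, any maximizer Ĵ_map of Π satisfies ‖X β̂_{Ĵ_map} − X β⋆‖₂ ≤ σ·√(8 s⋆ λ). -/
open MeasureTheory ProbabilityTheory Finset
open scoped Classical ENNReal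

/-- The coordinates of a centered isotropic Gaussian vector along an orthonormal family are
again a centered isotropic Gaussian vector with the same variance. -/
theorem map_inner_orthonormal_pi_gaussianReal {ι κ : Type*} [Fintype ι] [Fintype κ] (v : NNReal)
    {u : κ → EuclideanSpace ℝ ι} (hu : Orthonormal ℝ u) :
    (Measure.pi (fun _ : ι => gaussianReal 0 v)).map
        (fun z k => inner ℝ (u k) (WithLp.toLp 2 z)) =
      Measure.pi (fun _ : κ => gaussianReal 0 v) := by
  have hmeas : Measurable (fun (z : ι → ℝ) (k : κ) => inner ℝ (u k) (WithLp.toLp 2 z)) := by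
    fun_prop
  refine (MeasurableEquiv.toLp 2 (κ → ℝ)).map_measurableEquiv_injective ?_
  simp only [MeasurableEquiv.coe_toLp]
  have hprob : IsProbabilityMeasure ((Measure.pi (fun _ : ι => gaussianReal 0 v)).map
      (fun (z : ι → ℝ) (k : κ) => inner ℝ (u k) (WithLp.toLp 2 z))) :=
    Measure.isProbabilityMeasure_map hmeas.aemeasurable
  refine Measure.ext_of_charFun (E := EuclideanSpace ℝ κ) ?_
  ext t
  have hnorm : ∑ i, (∑ k, t k • u k) i ^ 2 = ∑ k, t k ^ 2 := by
    rw [← EuclideanSpace.real_norm_sq_eq, ← real_inner_self_eq_norm_sq, hu.inner_sum]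
    simp [sq]
  have h := charFun_pi (μ := fun _ : ι => gaussianReal 0 v) (∑ k, t k • u k)
  have h' := charFun_pi (μ := fun _ : κ => gaussianReal 0 v) t
  rw [h']
  have key : charFun (((Measure.pi (fun _ : ι => gaussianReal 0 v)).map
      (fun (z : ι → ℝ) (k : κ) => inner ℝ (u k) (WithLp.toLp 2 z))).map (WithLp.toLp 2)) t =
      charFun ((Measure.pi (fun _ : ι => gaussianReal 0 v)).map (WithLp.toLp 2))
        (∑ k, t k • u k) := by
    simp only [charFun_apply]
    rw [integral_map (by fun_prop) (by fun_prop), integral_map (by fun_prop) (by fun_prop),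
      integral_map (by fun_prop) (by fun_prop)]
    refine integral_congr_ae (Filter.Eventually.of_forall fun z => ?_)
    simp only
    congr 3
    rw [inner_sum, PiLp.inner_apply]
    simp [inner_smul_right, real_inner_comm]
  rw [key, h]
  simp only [charFun_gaussianReal, ← Complex.exp_sum]
  congr 1
  have hc : ∑ i, ((∑ k, t k • u k) i : ℂ) ^ 2 = ∑ k, (t k : ℂ) ^ 2 := by exact_mod_cast hnorm
  simp only [Complex.ofReal_zero, mul_zero, zero_mul, zero_sub, Finset.sum_neg_distrib,
    ← Finset.sum_div, ← Finset.mul_sum]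
  rw [hc]

theorem mgf_sq_gaussianReal {v : NNReal} (hv : v ≠ 0) :
    mgf (fun x => x ^ 2) (gaussianReal 0 v) (1 / (4 * v)) = Real.sqrt 2 := by
  have hv' : (0 : ℝ) < v := by positivity
  rw [mgf, integral_gaussianReal_eq_integral_smul hv]
  have : ∀ x : ℝ, gaussianPDFReal 0 v x • Real.exp (1 / (4 * v) * x ^ 2) =
      (Real.sqrt (2 * Real.pi * v))⁻¹ * Real.exp (-(1 / (4 * v)) * x ^ 2) := by
    intro x
    rw [gaussianPDFReal, smul_eq_mul, mul_assoc, ← Real.exp_add]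
    congr 2
    field_simp
    ring
  simp_rw [this]
  rw [integral_const_mul, integral_gaussian, ← Real.sqrt_inv, ← Real.sqrt_mul (by positivity)]
  congr 1
  field_simp
  norm_num

theorem integrable_exp_sq_gaussianReal {v : NNReal} (hv : v ≠ 0) :
    Integrable (fun x => Real.exp (1 / (4 * v) * x ^ 2)) (gaussianReal 0 v) := by
  refine Integrable.of_integral_ne_zero ?_
  have := mgf_sq_gaussianReal hv
  rw [mgf] at this
  rw [this]
  positivity

/-- Chernoff bound for the sum of squares of independent centered Gaussian variables. -/
theorem pi_gaussianReal_sum_sq_ge_le {κ : Type*} [Fintype κ] {v : NNReal} (hv : v ≠ 0) (ε : ℝ) :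
    (Measure.pi (fun _ : κ => gaussianReal 0 v)).real {x | ε ≤ ∑ k, x k ^ 2} ≤
      Real.exp (-(1 / (4 * v)) * ε) * Real.sqrt 2 ^ Fintype.card κ := by
  set ν := Measure.pi (fun _ : κ => gaussianReal 0 v)
  have hind : iIndepFun (fun (k : κ) (x : κ → ℝ) => x k ^ 2) ν :=
    iIndepFun_pi (X := fun _ x => x ^ 2) (fun _ => by fun_prop)
  have hmp (k : κ) := measurePreserving_eval (fun _ : κ => gaussianReal 0 v) k
  have hint (k : κ) : Integrable (fun x : κ → ℝ => Real.exp (1 / (4 * v) * x k ^ 2)) ν :=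
    (hmp k).integrable_comp_of_integrable (integrable_exp_sq_gaussianReal hv)
  have hmgf (k : κ) : mgf (fun x : κ → ℝ => x k ^ 2) ν (1 / (4 * v)) = Real.sqrt 2 := by
    rw [← mgf_sq_gaussianReal hv, ← (hmp k).map_eq, mgf_map (hmp k).measurable.aemeasurable (by fun_prop)]
    rfl
  have h := measure_ge_le_exp_mul_mgf (μ := ν) (t := 1 / (4 * v))
    (X := ∑ k, fun (x : κ → ℝ) => x k ^ 2) ε (by positivity)
    (hind.integrable_exp_mul_sum (fun k => by fun_prop) (fun k _ => hint k))
  rw [hind.mgf_sum (fun k => by fun_prop), Finset.prod_congr rfl fun k _ => hmgf k] at h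
  simpa using h

/-- Chernoff bound for the norm of the projection of an isotropic Gaussian vector. -/
theorem pi_gaussianReal_norm_starProjection_ge_le {ι : Type*} [Fintype ι] {v : NNReal}
    (hv : v ≠ 0) (W : Submodule ℝ (EuclideanSpace ℝ ι)) (ε : ℝ) :
    (Measure.pi (fun _ : ι => gaussianReal 0 v)).real
        {z | ε ≤ ‖W.starProjection (WithLp.toLp 2 z)‖ ^ 2} ≤
      Real.exp (-(1 / (4 * v)) * ε) * Real.sqrt 2 ^ Module.finrank ℝ W := by
  set b := stdOrthonormalBasis ℝ W
  have hu : Orthonormal ℝ (fun k => (b k : EuclideanSpace ℝ ι)) :=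
    b.orthonormal.comp_linearIsometry W.subtypeₗᵢ
  have hsq (z : EuclideanSpace ℝ ι) :
      ‖W.starProjection z‖ ^ 2 = ∑ k, inner ℝ (b k : EuclideanSpace ℝ ι) z ^ 2 := by
    rw [Submodule.starProjection_apply, ← Submodule.coe_norm, ← b.sum_sq_inner_right]
    refine Finset.sum_congr rfl fun k _ => ?_
    rw [Submodule.inner_orthogonalProjectionOnto_eq_of_mem_left]
  have h := pi_gaussianReal_sum_sq_ge_le (κ := Fin (Module.finrank ℝ W)) hv ε
  rw [← map_inner_orthonormal_pi_gaussianReal v hu, map_measureReal_apply (by fun_prop)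
    (measurableSet_le measurable_const (by fun_prop))] at h
  simpa [hsq] using h

/-- The basic inequality for approximate least squares restricted to a subspace. -/
theorem norm_sq_le_of_norm_sub_sq_le {E : Type*} [NormedAddCommGroup E] [InnerProductSpace ℝ E]
    (W : Submodule ℝ E) [W.HasOrthogonalProjection] {z d : E} (hd : d ∈ W) {B : ℝ}
    (h : ‖z - d‖ ^ 2 ≤ ‖z‖ ^ 2 + 2 * B) :
    ‖d‖ ^ 2 ≤ 4 * ‖W.starProjection z‖ ^ 2 + 4 * B := by
  have h1 : inner ℝ z d = inner ℝ (W.starProjection z) d := by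
    rw [Submodule.inner_starProjection_left_eq_right, Submodule.starProjection_eq_self_iff.2 hd]
  have h2 := real_inner_le_norm (W.starProjection z) d
  rw [norm_sub_sq_real, h1] at h
  nlinarith [sq_nonneg (2 * ‖W.starProjection z‖ - ‖d‖)]

theorem sum_erase_empty_pow_card_le {p : ℕ} {q : ℝ} (hq : 0 ≤ q) (hpq : p * q ≤ 1) :
    ∑ A ∈ (Finset.univ : Finset (Finset (Fin p))).erase ∅, q ^ A.card ≤ 2 * (p * q) := by
  have h1 : ∑ A : Finset (Fin p), q ^ A.card = (q + 1) ^ p := by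
    rw [← Fin.sum_pow_mul_eq_add_pow]
    simp
  have h2 := Finset.sum_erase_add (f := fun A : Finset (Fin p) => q ^ A.card) Finset.univ
    (Finset.mem_univ ∅)
  have h3 : (q + 1) ^ p ≤ Real.exp (p * q) := by
    rw [Real.exp_nat_mul]
    gcongr
    exact Real.add_one_le_exp q
  have h0 : 0 ≤ p * q := by positivity
  have h4 := (abs_le.1 (Real.abs_exp_sub_one_le (x := p * q) (by rwa [abs_of_nonneg h0]))).2
  rw [abs_of_nonneg h0] at h4
  simp only [Finset.card_empty, pow_zero] at h2
  linarith

/-- With high probability, the projections of an isotropic Gaussian vector onto a family of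
subspaces indexed by the nonempty subsets of a finite set, of dimensions bounded by their sizes,
are simultaneously controlled. -/
theorem one_sub_rpow_le_pi_gaussianReal_norm_starProjection_lt {ι : Type*} [Fintype ι]
    {v : NNReal} (hv : v ≠ 0) {p : ℕ} (hp : 2 ≤ p)
    (W : Finset (Fin p) → Submodule ℝ (EuclideanSpace ℝ ι))
    (hW : ∀ A, Module.finrank ℝ (W A) ≤ A.card) {c : ℝ} (hc : 0 < c) :
    1 - (p : ℝ) ^ (-c) ≤ (Measure.pi (fun _ : ι => gaussianReal 0 v)).real
      {z | ∀ A : Finset (Fin p), A.Nonempty → ‖(W A).starProjection (WithLp.toLp 2 z)‖ ^ 2 <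
        v * ((61 + 12 * c) * Real.log p * A.card)} := by
  set μ := Measure.pi (fun _ : ι => gaussianReal 0 v)
  set L := Real.log p
  have hp' : (2 : ℝ) ≤ p := by exact_mod_cast hp
  have hL : 0 < L := Real.log_pos (by linarith)
  have hpL : (p : ℝ) = Real.exp L := (Real.exp_log (by linarith)).symm
  set q := Real.sqrt 2 * Real.exp (-((61 + 12 * c) * L / 4)) with hq
  have hq0 : 0 ≤ q := by positivity
  have hsqrt : Real.sqrt 2 ≤ p := by
    refine le_trans ?_ hp'
    rw [Real.sqrt_le_left (by norm_num)]
    norm_num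
  have hq2 : 2 * (p * q) ≤ (p : ℝ) ^ (-c) := by
    calc 2 * (p * q) ≤ p * (p * (p * Real.exp (-((61 + 12 * c) * L / 4)))) := by
          rw [hq]
          gcongr
      _ = Real.exp (L + (L + (L + -((61 + 12 * c) * L / 4)))) := by
          rw [hpL, Real.exp_add, Real.exp_add, Real.exp_add]
      _ ≤ Real.exp (L * -c) := by
          gcongr
          nlinarith [mul_pos hL hc]
      _ = (p : ℝ) ^ (-c) := by rw [hpL, ← Real.exp_mul]
  have hpc : (p : ℝ) ^ (-c) ≤ 1 :=
    Real.rpow_le_one_of_one_le_of_nonpos (by linarith) (by linarith)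
  set B : Finset (Fin p) → Set (ι → ℝ) := fun A =>
    {z | v * ((61 + 12 * c) * L * A.card) ≤ ‖(W A).starProjection (WithLp.toLp 2 z)‖ ^ 2}
    with hB
  have hBmeas (A) : MeasurableSet (B A) := measurableSet_le measurable_const (by fun_prop)
  have htail (A) : μ.real (B A) ≤ q ^ A.card := by
    refine (pi_gaussianReal_norm_starProjection_ge_le hv (W A) _).trans ?_
    rw [hq, mul_pow, mul_comm, ← Real.exp_nat_mul]
    have hv' : (0 : ℝ) < v := by positivity
    have hexp : -(1 / (4 * (v : ℝ))) * (v * ((61 + 12 * c) * L * A.card)) =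
        A.card * -((61 + 12 * c) * L / 4) := by
      linear_combination (-((61 + 12 * c) * L * A.card) / 4) * mul_inv_cancel₀ hv'.ne'
    rw [hexp]
    exact mul_le_mul_of_nonneg_right
      (pow_le_pow_right₀ (Real.one_le_sqrt.2 (by norm_num)) (hW A)) (Real.exp_nonneg _)
  have hunion : μ.real (⋃ A ∈ (Finset.univ : Finset (Finset (Fin p))).erase ∅, B A) ≤
      (p : ℝ) ^ (-c) :=
    calc _ ≤ ∑ A ∈ (Finset.univ : Finset (Finset (Fin p))).erase ∅, μ.real (B A) :=
          measureReal_biUnion_finset_le _ _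
      _ ≤ ∑ A ∈ (Finset.univ : Finset (Finset (Fin p))).erase ∅, q ^ A.card :=
          Finset.sum_le_sum fun A _ => htail A
      _ ≤ 2 * (p * q) := sum_erase_empty_pow_card_le hq0 (by linarith)
      _ ≤ _ := hq2
  have hset : {z | ∀ A : Finset (Fin p), A.Nonempty →
      ‖(W A).starProjection (WithLp.toLp 2 z)‖ ^ 2 < v * ((61 + 12 * c) * L * A.card)} =
      (⋃ A ∈ (Finset.univ : Finset (Finset (Fin p))).erase ∅, B A)ᶜ := by
    ext z
    simp only [hB, Finset.nonempty_iff_ne_empty, Set.mem_ofPred_eq, Set.mem_compl_iff,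
      Set.mem_iUnion, Finset.mem_erase, Finset.mem_univ, and_true, not_exists, not_le]
  rw [hset, probReal_compl_eq_one_sub (Finset.measurableSet_biUnion _ fun A _ => hBmeas A)]
  linarith

/-- The span of the columns of a matrix indexed by a finite set. -/
noncomputable def columnSpan {n p : ℕ} (X : Matrix (Fin n) (Fin p) ℝ) (A : Finset (Fin p)) :
    Submodule ℝ (EuclideanSpace ℝ (Fin n)) :=
  Submodule.span ℝ ((A.image fun j => WithLp.toLp 2 (X.col j) : Finset _) : Set _)

theorem finrank_columnSpan_le {n p : ℕ} (X : Matrix (Fin n) (Fin p) ℝ) (A : Finset (Fin p)) :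
    Module.finrank ℝ (columnSpan X A) ≤ A.card :=
  (finrank_span_finset_le_card _).trans Finset.card_image_le

theorem toLp_mulVec_mem_columnSpan {n p : ℕ} (X : Matrix (Fin n) (Fin p) ℝ)
    {A : Finset (Fin p)} {b : Fin p → ℝ} (hb : ∀ j ∉ A, b j = 0) :
    WithLp.toLp 2 (X.mulVec b) ∈ columnSpan X A := by
  have : WithLp.toLp 2 (X.mulVec b) = ∑ j, b j • WithLp.toLp 2 (X.col j) := by
    ext i
    simp [Matrix.mulVec, dotProduct, mul_comm]
  rw [this]
  refine Submodule.sum_mem _ fun j _ => ?_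
  by_cases hj : j ∈ A
  · exact Submodule.smul_mem _ _ (Submodule.subset_span (by simpa using ⟨j, hj, rfl⟩))
  · simp [hb j hj]

/-- A least-squares residual is orthogonal to the vectors spanned by the columns in use. -/
theorem sum_residual_mul_mulVec_eq_zero {n p : ℕ} (X : Matrix (Fin n) (Fin p) ℝ)
    {J : Finset (Fin p)} {r : Fin n → ℝ} (hr : ∀ j ∈ J, ∑ i, r i * X i j = 0)
    {b : Fin p → ℝ} (hb : ∀ j ∉ J, b j = 0) : ∑ i, r i * X.mulVec b i = 0 := by
  simp only [Matrix.mulVec, dotProduct, Finset.mul_sum]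
  rw [Finset.sum_comm]
  refine Finset.sum_eq_zero fun j _ => ?_
  by_cases hj : j ∈ J
  · simp_rw [← mul_assoc]
    rw [← Finset.sum_mul, hr j hj, zero_mul]
  · simp [hb j hj]

/-- Comparing two unnormalized posterior weights compares the residual sums of squares. -/
theorem residual_le_of_weight_le {p k s : ℕ} (hp : 2 ≤ p) (hs : s ≤ p) (hk : k ≤ p)
    {lam σ R R' : ℝ} (hσ : 0 < σ)
    (h : ((p.choose s : ℝ))⁻¹ * Real.exp (-(lam * s)) * Real.exp (-R / (2 * σ ^ 2)) ≤
      ((p.choose k : ℝ))⁻¹ * Real.exp (-(lam * k)) * Real.exp (-R' / (2 * σ ^ 2))) :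
    R' ≤ R + 2 * (σ ^ 2 * (s * Real.log p + lam * s - lam * k)) := by
  have hp' : (0 : ℝ) < p := by exact_mod_cast (by omega : 0 < p)
  have h1 : Real.exp (-(s * Real.log p)) ≤ ((p.choose s : ℝ))⁻¹ := by
    rw [Real.exp_neg, Real.exp_nat_mul, Real.exp_log hp']
    have : (0 : ℝ) < p.choose s := by exact_mod_cast Nat.choose_pos hs
    gcongr
    exact_mod_cast Nat.choose_le_pow p s
  have h2 : ((p.choose k : ℝ))⁻¹ ≤ 1 :=
    inv_le_one_of_one_le₀ (by exact_mod_cast Nat.choose_pos hk)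
  have h3 : Real.exp (-(s * Real.log p)) * Real.exp (-(lam * s)) * Real.exp (-R / (2 * σ ^ 2)) ≤
      1 * Real.exp (-(lam * k)) * Real.exp (-R' / (2 * σ ^ 2)) := by
    calc _ ≤ _ := by gcongr
      _ ≤ _ := h
      _ ≤ _ := by gcongr
  rw [one_mul, ← Real.exp_add, ← Real.exp_add, ← Real.exp_add, Real.exp_le_exp] at h3
  have h4 : (R' - R) / (2 * σ ^ 2) ≤ s * Real.log p + lam * s - lam * k := by
    rw [sub_div]
    simp only [neg_div] at h3
    linarith
  rw [div_le_iff₀ (by positivity)] at h4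
  linarith

theorem stmt0
    (n p : ℕ) (hn : 1 ≤ n) (hnp : n ≤ p) (hp2 : 2 ≤ p)
    (X : Matrix (Fin n) (Fin p) ℝ)
    (hX : ∀ j, Real.sqrt (∑ i, (X i j)^2) = Real.sqrt n)
    (σ : ℝ) (hσ : 0 < σ)
    (βs : Fin p → ℝ) (sstar : ℕ) (hs1 : 1 ≤ sstar)
    (Jstar : Finset (Fin p)) (hJstar : Jstar = Finset.univ.filter (fun j => βs j ≠ 0))
    (hcard : Jstar.card = sstar)
    (P : Finset (Fin p) → (Fin n → ℝ) → (Fin n → ℝ))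
    (hP : ∀ (J : Finset (Fin p)) (v : Fin n → ℝ),
        (∃ cf : Fin p → ℝ, (∀ j ∉ J, cf j = 0) ∧ P J v = X.mulVec cf)
        ∧ ∀ j ∈ J, (∑ i, (v i - P J v i) * X i j) = 0)
    (μ : Measure (Fin n → ℝ))
    (hμ : μ = Measure.pi (fun _ : Fin n => gaussianReal 0 (Real.toNNReal (σ^2))))
    (hminimal : ∀ b : Fin p → ℝ, X.mulVec b = X.mulVec βs →
        sstar ≤ (Finset.univ.filter (fun j => b j ≠ 0)).card)
    (y : (Fin n → ℝ) → Fin n → ℝ)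
    (hy : ∀ z i, y z i = X.mulVec βs i + z i)
    (sbar : ℕ) (hsbar1 : sstar ≤ sbar) (hsbar2 : sbar ≤ p)
    (lam : ℝ)
    (w Post : (Fin n → ℝ) → Finset (Fin p) → ℝ)
    (hw : ∀ z J, w z J = if J.card ≤ sbar then
        ((p.choose J.card : ℝ))⁻¹ * Real.exp (-(lam * (J.card : ℝ)))
          * Real.exp (-(∑ i, (y z i - P J (y z) i)^2) / (2 * σ^2)) else 0)
    (hPost : ∀ z J, Post z J = w z J / ∑ J' : Finset (Fin p), w z J')
    (bh : (Fin n → ℝ) → Finset (Fin p) → Fin p → ℝ)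
    (hbh : ∀ z J, (∀ j ∉ J, bh z J j = 0)
        ∧ X.mulVec (bh z J) = P J (y z)
        ∧ ∀ b : Fin p → ℝ, (∀ j ∉ J, b j = 0) → X.mulVec b = P J (y z) →
            ∑ j, (bh z J j)^2 ≤ ∑ j, (b j)^2)
    (c : ℝ) (hc : 0 < c)
    (hlam : lam = (62 + 12 * c) * Real.log p)
    :
    ENNReal.ofReal (1 - (p : ℝ) ^ (-c)) ≤
      μ {z | ∀ Jh : Finset (Fin p), Post z Jstar ≤ Post z Jh →
        Real.sqrt (∑ i, (X.mulVec (bh z Jh) i - X.mulVec βs i)^2)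
          ≤ σ * Real.sqrt (8 * (sstar : ℝ) * lam)} := by
  set v : NNReal := Real.toNNReal (σ ^ 2) with hv
  have hvσ : (v : ℝ) = σ ^ 2 := Real.coe_toNNReal _ (sq_nonneg σ)
  have hv0 : v ≠ 0 := by
    rw [← NNReal.coe_ne_zero, hvσ]
    positivity
  have hgood := one_sub_rpow_le_pi_gaussianReal_norm_starProjection_lt hv0 hp2 (columnSpan X)
    (finrank_columnSpan_le X) hc
  rw [← hμ] at hgood
  have hprob : IsProbabilityMeasure μ := by
    rw [hμ]
    infer_instance
  refine (ENNReal.ofReal_le_ofReal hgood).trans ?_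
  rw [ofReal_measureReal]
  refine measure_mono fun z hz J hJ => ?_
  have hL : 0 < Real.log p := Real.log_pos (by exact_mod_cast (by omega : 1 < p))
  have hβ : ∀ j ∉ Jstar, βs j = 0 := by
    intro j hj
    simpa [hJstar] using hj
  have hwpos : 0 < w z Jstar := by
    have := Nat.choose_pos (hsbar1.trans hsbar2)
    rw [hw, if_pos (by omega), hcard]
    positivity
  have hwnonneg (J' : Finset (Fin p)) : 0 ≤ w z J' := by
    rw [hw]
    split_ifs <;> positivity
  have hsum : 0 < ∑ J' : Finset (Fin p), w z J' :=
    hwpos.trans_le (Finset.single_le_sum (fun J' _ => hwnonneg J') (Finset.mem_univ Jstar))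
  have hwle : w z Jstar ≤ w z J := by
    rwa [hPost, hPost, div_le_div_iff_of_pos_right hsum] at hJ
  have hJcard : J.card ≤ sbar := by
    by_contra hcon
    have := hw z J
    rw [if_neg hcon] at this
    linarith
  rw [hw, hw, if_pos hJcard, if_pos (by omega), hcard] at hwle
  have hres := residual_le_of_weight_le hp2 (hsbar1.trans hsbar2) (hJcard.trans hsbar2) hσ hwle
  have hresstar : ∑ i, (y z i - P Jstar (y z) i) ^ 2 ≤ ∑ i, z i ^ 2 := by
    obtain ⟨⟨cf, hcf, hPcf⟩, horth⟩ := hP Jstar (y z)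
    have h0 := sum_residual_mul_mulVec_eq_zero X horth (b := cf - βs)
      (fun j hj => by simp [hcf j hj, hβ j hj])
    have hexp : ∑ i, z i ^ 2 = ∑ i, (y z i - P Jstar (y z) i) ^ 2 +
        ∑ i, X.mulVec (cf - βs) i ^ 2 +
        2 * ∑ i, (y z i - P Jstar (y z) i) * X.mulVec (cf - βs) i := by
      rw [Finset.mul_sum, ← Finset.sum_add_distrib, ← Finset.sum_add_distrib]
      refine Finset.sum_congr rfl fun i _ => ?_
      rw [hPcf, hy, Matrix.mulVec_sub, Pi.sub_apply]
      ring
    have : 0 ≤ ∑ i, X.mulVec (cf - βs) i ^ 2 := Finset.sum_nonneg fun i _ => sq_nonneg _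
    linarith
  obtain ⟨hbJ, hbP, -⟩ := hbh z J
  have hd := toLp_mulVec_mem_columnSpan X (A := J ∪ Jstar) (b := bh z J - βs) (fun j hj => by
    rw [Finset.mem_union, not_or] at hj
    simp [hbJ j hj.1, hβ j hj.2])
  have hdsq := norm_sq_le_of_norm_sub_sq_le (columnSpan X (J ∪ Jstar)) (z := WithLp.toLp 2 z) hd
    (B := σ ^ 2 * (sstar * Real.log p + lam * sstar - lam * J.card)) (by
      simp only [EuclideanSpace.real_norm_sq_eq, PiLp.sub_apply, Matrix.mulVec_sub, Pi.sub_apply]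
      have : ∑ i, (z i - (X.mulVec (bh z J) i - X.mulVec βs i)) ^ 2 =
          ∑ i, (y z i - P J (y z) i) ^ 2 := by
        refine Finset.sum_congr rfl fun i _ => ?_
        rw [← hbP, hy]
        ring
      linarith)
  have hne : (J ∪ Jstar).Nonempty := by
    refine Finset.Nonempty.inr (Finset.card_pos.1 ?_)
    omega
  have hproj := hz (J ∪ Jstar) hne
  rw [hvσ] at hproj
  have hcardU : ((J ∪ Jstar).card : ℝ) ≤ J.card + sstar := by
    rw [← hcard]
    exact_mod_cast Finset.card_union_le J Jstar
  simp only [EuclideanSpace.real_norm_sq_eq _, Matrix.mulVec_sub, Pi.sub_apply] at hdsq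
  rw [← EuclideanSpace.real_norm_sq_eq] at hdsq
  rw [← Real.sqrt_sq hσ.le, ← Real.sqrt_mul (sq_nonneg σ)]
  refine Real.sqrt_le_sqrt ?_
  have hU : (61 + 12 * c) * Real.log p * (J ∪ Jstar).card ≤
      (61 + 12 * c) * Real.log p * (J.card + sstar) := by gcongr
  have hJL : 0 ≤ Real.log p * J.card := by positivity
  have hfin : (61 + 12 * c) * Real.log p * (J ∪ Jstar).card +
      (sstar * Real.log p + lam * sstar - lam * J.card) ≤ 2 * (sstar * lam) := by
    rw [hlam]
    linarith
  have := mul_le_mul_of_nonneg_left hfin (sq_nonneg σ)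
  linarith
end

section
/- Let λ = (62 + 12c)·log p for some c > 0, and let β̂_mean = Σ_J Π(J)·β̂_J be the posterior mean (so that X β̂_mean = Σ_J Π(J)·P_J y). Then with probability at least 1 − p^(−c) over the Gaussian noise z, ‖X β̂_mean − X β⋆‖₂ = ‖Σ_J Π(J)·P_J y − X β⋆‖₂ ≤ σ·√(12 s⋆ λ). -/
open MeasureTheory ProbabilityTheory Finset
open scoped Classical ENNReal

lemma integrable_exp_sq_div_four_gaussianReal :
    Integrable (fun x : ℝ => Real.exp (x ^ 2 / 4)) (gaussianReal 0 1) := by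
  rw [gaussianReal_of_var_ne_zero 0 one_ne_zero]
  rw [gaussianPDF_def, integrable_withDensity_iff_integrable_smul₀' (by fun_prop) (by simp)]
  have := (integrable_exp_neg_mul_sq (b := 1 / 4) (by norm_num)).const_mul (√(2 * Real.pi))⁻¹
  refine this.congr (.of_forall fun x => ?_)
  simp only [gaussianPDFReal, NNReal.coe_one, mul_one, sub_zero, smul_eq_mul]
  rw [ENNReal.toReal_ofReal (by positivity), mul_assoc, ← Real.exp_add]
  ring_nf

lemma integral_exp_sq_div_four_gaussianReal :
    ∫ x : ℝ, Real.exp (x ^ 2 / 4) ∂(gaussianReal 0 1) = √2 := by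
  rw [integral_gaussianReal_eq_integral_smul one_ne_zero]
  have h (x : ℝ) : gaussianPDFReal 0 1 x • Real.exp (x ^ 2 / 4)
      = (√(2 * Real.pi))⁻¹ * Real.exp (-(1 / 4) * x ^ 2) := by
    simp only [gaussianPDFReal, NNReal.coe_one, mul_one, sub_zero, smul_eq_mul]
    rw [mul_assoc, ← Real.exp_add]
    ring_nf
  simp_rw [h]
  rw [integral_const_mul, integral_gaussian, inv_mul_eq_div, ← Real.sqrt_div (by positivity)]
  congr 1
  field_simp
  norm_num

lemma exp_norm_sq_div_four_sum_smul {E ι : Type*} [NormedAddCommGroup E]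
    [InnerProductSpace ℝ E] [Fintype ι] (b : OrthonormalBasis ι ℝ E) (x : ι → ℝ) :
    Real.exp (‖∑ i, x i • b i‖ ^ 2 / 4) = ∏ i, Real.exp (x i ^ 2 / 4) := by
  have h : ‖∑ i, x i • b i‖ ^ 2 = ∑ i, x i ^ 2 := by
    rw [← real_inner_self_eq_norm_sq, b.orthonormal.inner_sum]
    simp [sq]
  rw [h, ← Real.exp_sum, Finset.sum_div]

section
variable {E : Type*} [NormedAddCommGroup E] [InnerProductSpace ℝ E] [FiniteDimensional ℝ E]
  [MeasurableSpace E] [BorelSpace E]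

lemma integrable_exp_norm_sq_div_four_stdGaussian :
    Integrable (fun x : E => Real.exp (‖x‖ ^ 2 / 4)) (stdGaussian E) := by
  rw [stdGaussian_eq_map_pi_orthonormalBasis (stdOrthonormalBasis ℝ E),
    integrable_map_measure (by fun_prop) (Measurable.aemeasurable (by fun_prop))]
  simp_rw [Function.comp_def, exp_norm_sq_div_four_sum_smul]
  exact Integrable.fintype_prod fun _ => integrable_exp_sq_div_four_gaussianReal

lemma integral_exp_norm_sq_div_four_stdGaussian :
    ∫ x : E, Real.exp (‖x‖ ^ 2 / 4) ∂(stdGaussian E) = √2 ^ Module.finrank ℝ E := by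
  rw [stdGaussian_eq_map_pi_orthonormalBasis (stdOrthonormalBasis ℝ E),
    integral_map (Measurable.aemeasurable (by fun_prop)) (by fun_prop)]
  simp_rw [exp_norm_sq_div_four_sum_smul]
  rw [integral_fintype_prod_eq_prod (fun _ (x : ℝ) => Real.exp (x ^ 2 / 4))]
  simp [integral_exp_sq_div_four_gaussianReal]

lemma stdGaussian_map_orthogonalProjection (S : Submodule ℝ E) :
    (stdGaussian E).map S.orthogonalProjectionOnto = stdGaussian S := by
  have : IsProbabilityMeasure ((stdGaussian E).map S.orthogonalProjectionOnto) :=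
    Measure.isProbabilityMeasure_map (by fun_prop)
  refine Measure.ext_of_charFun (funext fun t => ?_)
  rw [charFun_apply, integral_map (by fun_prop) (by fun_prop), charFun_stdGaussian]
  simp_rw [Submodule.coe_inner, ← Submodule.starProjection_apply]
  have h (x : E) : inner ℝ (S.starProjection x) (t : E) = inner ℝ x (t : E) := by
    rw [Submodule.inner_starProjection_left_eq_right, Submodule.starProjection_eq_self_iff.2 t.2]
  simp_rw [h, ← charFun_apply, charFun_stdGaussian]
  simp

lemma measureReal_stdGaussian_le_norm_sq (t : ℝ) :
    (stdGaussian E).real {x | t ≤ ‖x‖ ^ 2} ≤ Real.exp (-t / 4) * √2 ^ Module.finrank ℝ E := by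
  have hf (x : E) : 1 / 4 * ‖x‖ ^ 2 = ‖x‖ ^ 2 / 4 := by ring
  have h := measure_ge_le_exp_mul_mgf (μ := stdGaussian E) (X := fun x => ‖x‖ ^ 2) (t := 1 / 4)
    t (by norm_num) (by simpa only [hf] using integrable_exp_norm_sq_div_four_stdGaussian)
  simp only [mgf, hf, integral_exp_norm_sq_div_four_stdGaussian] at h
  convert h using 3
  ring

lemma stdGaussian_le_norm_sq_starProjection (S : Submodule ℝ E) (t : ℝ) :
    (stdGaussian E).real {x | t ≤ ‖S.starProjection x‖ ^ 2}
      ≤ Real.exp (-t / 4) * √2 ^ Module.finrank ℝ S := by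
  have h := measureReal_stdGaussian_le_norm_sq (E := S) t
  rwa [← stdGaussian_map_orthogonalProjection, map_measureReal_apply (by fun_prop)
    (measurableSet_le (by fun_prop) (by fun_prop))] at h
end

lemma pi_gaussianReal_zero_eq_map_stdGaussian {ι : Type*} [Fintype ι] (σ : ℝ) :
    Measure.pi (fun _ : ι => gaussianReal 0 (Real.toNNReal (σ ^ 2)))
      = (stdGaussian (EuclideanSpace ℝ ι)).map (fun x => σ • x.ofLp) := by
  rw [← map_pi_eq_stdGaussian, Measure.map_map (by fun_prop) (by fun_prop)]
  have h : gaussianReal 0 (Real.toNNReal (σ ^ 2)) = (gaussianReal 0 1).map (σ * ·) := by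
    rw [gaussianReal_map_const_mul]
    congr 1
    · simp
    · ext; simp [sq_nonneg]
  have h1 : IsProbabilityMeasure ((gaussianReal 0 1).map (σ * ·)) := by
    rw [← h]; infer_instance
  rw [h, ← Measure.pi_map_pi (fun _ => by fun_prop)]
  rfl

lemma sum_inv_choose_mul_exp_le_two {p : ℕ} (hp : 2 ≤ p) :
    ∑ J : Finset (Fin p), ((p.choose #J : ℝ))⁻¹ * Real.exp (-(Real.log p * #J)) ≤ 2 := by
  have h := Finset.sum_powerset_apply_card
    (fun k => ((p.choose k : ℝ))⁻¹ * Real.exp (-(Real.log p * k))) (x := (univ : Finset (Fin p)))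
  rw [Finset.powerset_univ, Finset.card_univ, Fintype.card_fin] at h
  rw [h]
  refine le_trans (Finset.sum_le_sum fun k hk => ?_) (sum_geometric_two_le (p + 1))
  have hk' : k ≤ p := Nat.lt_succ_iff.1 (Finset.mem_range.1 hk)
  have hc : (0 : ℝ) < p.choose k := by exact_mod_cast Nat.choose_pos hk'
  rw [nsmul_eq_mul, mul_inv_cancel_left₀ hc.ne', one_div, inv_pow, Real.exp_neg, Real.exp_mul,
    Real.exp_log (by positivity), Real.rpow_natCast]
  gcongr
  exact_mod_cast hp

lemma exp_sum_weight_mul_le {p : ℕ} (hp : 2 ≤ p) (w h : Finset (Fin p) → ℝ) (A : ℝ) (hA : 0 ≤ A)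
    (hw : ∀ J, 0 ≤ w J) (hW : 0 < ∑ J, w J)
    (hub : ∀ J, w J * Real.exp (h J)
      ≤ A * ((p.choose #J : ℝ)⁻¹ * Real.exp (-(Real.log p * #J)))) :
    (∑ J, w J) * Real.exp (∑ J, w J / (∑ J', w J') * h J) ≤ 2 * A := by
  have h1 := convexOn_exp.map_sum_le (t := (univ : Finset (Finset (Fin p))))
    (w := fun J => w J / ∑ J', w J') (p := h) (fun J _ => div_nonneg (hw J) hW.le)
    (by rw [← Finset.sum_div, div_self hW.ne']) (fun _ _ => Set.mem_univ _)
  simp only [smul_eq_mul] at h1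
  calc _ ≤ (∑ J, w J) * ∑ J, w J / (∑ J', w J') * Real.exp (h J) := by gcongr
    _ = ∑ J, w J * Real.exp (h J) := by
      rw [Finset.mul_sum]
      refine Finset.sum_congr rfl fun J _ => ?_
      field_simp
    _ ≤ ∑ J : Finset (Fin p), A * ((p.choose #J : ℝ)⁻¹ * Real.exp (-(Real.log p * #J))) :=
      Finset.sum_le_sum fun J _ => hub J
    _ ≤ 2 * A := by
      rw [← Finset.mul_sum, mul_comm]
      gcongr
      exact sum_inv_choose_mul_exp_le_two hp

lemma stdGaussian_projections_le {n p : ℕ} (hp : 2 ≤ p) (v : Fin p → EuclideanSpace ℝ (Fin n))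
    {c : ℝ} (hc : 0 < c) :
    ENNReal.ofReal (1 - (p : ℝ) ^ (-c)) ≤ stdGaussian (EuclideanSpace ℝ (Fin n))
      {x | ∀ K : Finset (Fin p), K.Nonempty →
        ‖(Submodule.span ℝ (v '' K)).starProjection x‖ ^ 2 ≤ (61 + 12 * c) * (Real.log p * #K)} := by
  set γ := stdGaussian (EuclideanSpace ℝ (Fin n))
  set bad : Finset (Fin p) → Set (EuclideanSpace ℝ (Fin n)) := fun K =>
    {x | (61 + 12 * c) * (Real.log p * #K) ≤ ‖(Submodule.span ℝ (v '' K)).starProjection x‖ ^ 2}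
  have hbad_meas (K) : MeasurableSet (bad K) := measurableSet_le (by fun_prop) (by fun_prop)
  have hp0 : (0 : ℝ) < p := by positivity
  have hp2 : (2 : ℝ) ≤ p := by exact_mod_cast hp
  have hL : 0 < Real.log p := Real.log_pos (by linarith)
  have hbad (K : Finset (Fin p)) (hK : K.Nonempty) : γ.real (bad K) ≤
      (p : ℝ) ^ (-c) / 2 * ((p.choose #K : ℝ)⁻¹ * Real.exp (-(Real.log p * #K))) := by
    have hk : (1 : ℝ) ≤ #K := by exact_mod_cast hK.card_pos
    have hdim : Module.finrank ℝ (Submodule.span ℝ (v '' K)) ≤ #K := by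
      rw [← Finset.coe_image]
      exact (finrank_span_finset_le_card _).trans Finset.card_image_le
    have hsqrt : √2 ^ Module.finrank ℝ (Submodule.span ℝ (v '' K)) ≤
        Real.exp (Real.log p * #K) := by
      have h1 : (1 : ℝ) ≤ √2 := Real.one_le_sqrt.2 (by norm_num)
      have h2 : √2 ≤ p := (Real.sqrt_le_iff.2 ⟨by norm_num, by norm_num⟩).trans hp2
      calc √2 ^ Module.finrank ℝ (Submodule.span ℝ (v '' K)) ≤ √2 ^ #K :=
            pow_le_pow_right₀ h1 hdim
        _ ≤ (p : ℝ) ^ #K := by gcongr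
        _ = _ := by rw [Real.exp_mul, Real.exp_log hp0, Real.rpow_natCast]
    have hchoose : Real.exp (-(Real.log p * #K)) ≤ (p.choose #K : ℝ)⁻¹ := by
      have hKp : #K ≤ p := by simpa using Finset.card_le_univ K
      have h1 : (0 : ℝ) < p.choose #K := by exact_mod_cast Nat.choose_pos hKp
      rw [Real.exp_neg, Real.exp_mul, Real.exp_log hp0, Real.rpow_natCast]
      gcongr
      exact_mod_cast Nat.choose_le_pow p #K
    have hhalf : Real.exp (-Real.log p) ≤ 1 / 2 := by
      rw [Real.exp_neg, Real.exp_log hp0, ← one_div]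
      gcongr
    have hpc : (p : ℝ) ^ (-c) = Real.exp (Real.log p * -c) := Real.rpow_def_of_pos hp0 _
    calc γ.real (bad K) ≤ _ := stdGaussian_le_norm_sq_starProjection _ _
      _ ≤ Real.exp (-((61 + 12 * c) * (Real.log p * #K)) / 4) * Real.exp (Real.log p * #K) := by
        gcongr
      _ ≤ Real.exp (Real.log p * -c) * Real.exp (-Real.log p) *
          (Real.exp (-(Real.log p * #K)) * Real.exp (-(Real.log p * #K))) := by
        simp only [← Real.exp_add]
        rw [Real.exp_le_exp]
        have hLk : Real.log p ≤ Real.log p * #K := le_mul_of_one_le_right hL.le hk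
        nlinarith [mul_le_mul_of_nonneg_left hLk hc.le]
      _ ≤ Real.exp (Real.log p * -c) * (1 / 2) *
          ((p.choose #K : ℝ)⁻¹ * Real.exp (-(Real.log p * #K))) := by gcongr
      _ = _ := by rw [hpc]; ring
  set B := ⋃ K ∈ (univ.filter fun K : Finset (Fin p) => K.Nonempty), bad K
  have hB : γ.real B ≤ (p : ℝ) ^ (-c) := by
    calc γ.real B ≤ ∑ K : Finset (Fin p) with K.Nonempty, γ.real (bad K) :=
          measureReal_biUnion_finset_le _ _
      _ ≤ ∑ K : Finset (Fin p) with K.Nonempty, (p : ℝ) ^ (-c) / 2 *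
            ((p.choose #K : ℝ)⁻¹ * Real.exp (-(Real.log p * #K))) :=
          Finset.sum_le_sum fun K hK => hbad K (Finset.mem_filter.1 hK).2
      _ ≤ ∑ K : Finset (Fin p), (p : ℝ) ^ (-c) / 2 *
            ((p.choose #K : ℝ)⁻¹ * Real.exp (-(Real.log p * #K))) :=
          Finset.sum_le_sum_of_subset_of_nonneg (Finset.filter_subset _ _)
            fun _ _ _ => by positivity
      _ ≤ (p : ℝ) ^ (-c) / 2 * 2 := by
          rw [← Finset.mul_sum]
          gcongr
          exact sum_inv_choose_mul_exp_le_two hp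
      _ = _ := by ring
  have hBm : MeasurableSet B := Finset.measurableSet_biUnion _ fun K _ => hbad_meas K
  calc ENNReal.ofReal (1 - (p : ℝ) ^ (-c)) ≤ ENNReal.ofReal (γ.real Bᶜ) := by
        rw [probReal_compl_eq_one_sub hBm]
        gcongr
    _ = γ Bᶜ := ofReal_measureReal
    _ ≤ _ := by
      refine measure_mono fun x hx K hK => ?_
      simp only [B, bad, Set.mem_compl_iff, Set.mem_iUnion, Set.mem_ofPred_eq, not_exists,
        Finset.mem_filter, Finset.mem_univ, true_and, not_le] at hx
      exact (hx K hK).le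

lemma norm_sq_sub_two_mul_norm_sq_starProjection_le {E : Type*} [NormedAddCommGroup E]
    [InnerProductSpace ℝ E] (S : Submodule ℝ E) [S.HasOrthogonalProjection] (z u : E)
    (hu : u ∈ S) :
    ‖z‖ ^ 2 + ‖u‖ ^ 2 / 2 - 2 * ‖S.starProjection z‖ ^ 2 ≤ ‖z - u‖ ^ 2 := by
  have h1 : inner ℝ z u = inner ℝ (S.starProjection z) u := by
    rw [Submodule.inner_starProjection_left_eq_right, Submodule.starProjection_eq_self_iff.2 hu]
  have h2 := norm_sub_sq_real u ((2 : ℝ) • S.starProjection z)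
  rw [inner_smul_right, norm_smul, Real.norm_ofNat, real_inner_comm] at h2
  rw [norm_sub_sq_real, h1]
  nlinarith [sq_nonneg ‖u - (2 : ℝ) • S.starProjection z‖]

lemma posterior_expected_sq_error_le {E : Type*} [NormedAddCommGroup E] [InnerProductSpace ℝ E]
    [FiniteDimensional ℝ E] {p : ℕ} (hp : 2 ≤ p) (v : Fin p → E) (Js : Finset (Fin p))
    (hJs : Js.Nonempty) (m z : E) (hm : m ∈ Submodule.span ℝ (v '' Js))
    (f : Finset (Fin p) → E) (hf : ∀ J : Finset (Fin p), f J ∈ Submodule.span ℝ (v '' J))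
    (hbest : ‖m + z - f Js‖ ≤ ‖z‖) {σ : ℝ} (hσ : 0 < σ) {C : ℝ} (hC : 0 ≤ C)
    (hz : ∀ K : Finset (Fin p), K.Nonempty →
      ‖(Submodule.span ℝ (v '' K)).starProjection z‖ ^ 2 ≤ σ ^ 2 * (C * (Real.log p * #K)))
    (sbar : ℕ) (hsbar : #Js ≤ sbar) (w : Finset (Fin p) → ℝ)
    (hw : ∀ J, w J = if #J ≤ sbar then ((p.choose #J : ℝ))⁻¹
      * Real.exp (-((C + 1) * Real.log p * (#J : ℝ)))
      * Real.exp (-‖m + z - f J‖ ^ 2 / (2 * σ ^ 2)) else 0) :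
    (∀ J, 0 ≤ w J) ∧ 0 < ∑ J, w J ∧ ∑ J, w J / (∑ J', w J') * ‖f J - m‖ ^ 2 ≤
      σ ^ 2 * (12 * #Js * ((C + 1) * Real.log p)) := by
  have hp0 : (0 : ℝ) < p := by positivity
  have hp2 : (2 : ℝ) ≤ p := by exact_mod_cast hp
  have hL : 0 < Real.log p := Real.log_pos (by linarith)
  have hs : (1 : ℝ) ≤ #Js := by exact_mod_cast hJs.card_pos
  have hw0 (J) : 0 ≤ w J := by rw [hw]; split_ifs <;> positivity
  have hchoose : (0 : ℝ) < p.choose #Js := by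
    exact_mod_cast Nat.choose_pos (by simpa using Finset.card_le_univ Js)
  have hlb : ((p.choose #Js : ℝ))⁻¹ * Real.exp (-((C + 1) * Real.log p * (#Js : ℝ)))
      * Real.exp (-‖z‖ ^ 2 / (2 * σ ^ 2)) ≤ ∑ J, w J := by
    refine le_trans ?_ (Finset.single_le_sum (fun J _ => hw0 J) (Finset.mem_univ Js))
    rw [hw, if_pos hsbar]
    gcongr
  have hW : 0 < ∑ J, w J := lt_of_lt_of_le (by positivity) hlb
  have hub (J : Finset (Fin p)) : w J * Real.exp (‖f J - m‖ ^ 2 / (4 * σ ^ 2)) ≤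
      (Real.exp (-‖z‖ ^ 2 / (2 * σ ^ 2)) * Real.exp (C * (Real.log p * #Js))) *
        ((p.choose #J : ℝ)⁻¹ * Real.exp (-(Real.log p * #J))) := by
    rw [hw]
    split_ifs
    swap
    · rw [zero_mul]; positivity
    have hle (K L : Finset (Fin p)) (h : K ⊆ L) :
        Submodule.span ℝ (v '' K) ≤ Submodule.span ℝ (v '' L) :=
      Submodule.span_mono (Set.image_mono (by exact_mod_cast h))
    have hmem : f J - m ∈ Submodule.span ℝ (v '' (J ∪ Js : Finset (Fin p))) :=
      Submodule.sub_mem _ (hle _ _ Finset.subset_union_left (hf J))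
        (hle _ _ Finset.subset_union_right hm)
    have h1 := norm_sq_sub_two_mul_norm_sq_starProjection_le _ z _ hmem
    have h2 := hz (J ∪ Js) (hJs.mono Finset.subset_union_right)
    have hcard : (#(J ∪ Js) : ℝ) ≤ #J + #Js := by exact_mod_cast Finset.card_union_le J Js
    have h3 : C * (Real.log p * #(J ∪ Js)) ≤ C * (Real.log p * (#J + #Js)) := by gcongr
    have h4 : ‖f J - m‖ ^ 2 / (4 * σ ^ 2) ≤ ‖m + z - f J‖ ^ 2 / (2 * σ ^ 2)
        - ‖z‖ ^ 2 / (2 * σ ^ 2) + C * (Real.log p * (#J + #Js)) := by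
      have h5 : z - (f J - m) = m + z - f J := by abel
      rw [h5] at h1
      have h6 := mul_le_mul_of_nonneg_left h3 (sq_nonneg σ)
      have h7 : ‖f J - m‖ ^ 2 ≤ 2 * ‖m + z - f J‖ ^ 2 - 2 * ‖z‖ ^ 2
          + 4 * σ ^ 2 * (C * (Real.log p * (#J + #Js))) := by linarith
      rw [div_le_iff₀ (by positivity)]
      refine h7.trans_eq ?_
      field_simp
      ring
    calc _ = (p.choose #J : ℝ)⁻¹ * Real.exp (-((C + 1) * Real.log p * #J)
          + -‖m + z - f J‖ ^ 2 / (2 * σ ^ 2) + ‖f J - m‖ ^ 2 / (4 * σ ^ 2)) := by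
          rw [Real.exp_add, Real.exp_add]; ring
      _ ≤ (p.choose #J : ℝ)⁻¹ * Real.exp (-‖z‖ ^ 2 / (2 * σ ^ 2) + C * (Real.log p * #Js)
          + -(Real.log p * #J)) := by
          gcongr (p.choose #J : ℝ)⁻¹ * Real.exp ?_
          simp only [neg_div]
          linarith
      _ = _ := by rw [Real.exp_add, Real.exp_add]; ring
  refine ⟨hw0, hW, ?_⟩
  have h := exp_sum_weight_mul_le hp w _ _ (by positivity) hw0 hW hub
  set H := ∑ J, w J / (∑ J', w J') * (‖f J - m‖ ^ 2 / (4 * σ ^ 2)) with hH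
  have hsum : ∑ J, w J / (∑ J', w J') * ‖f J - m‖ ^ 2 = 4 * σ ^ 2 * H := by
    rw [hH, Finset.mul_sum]
    refine Finset.sum_congr rfl fun J _ => ?_
    field_simp
  have hchoose_le : (p.choose #Js : ℝ) ≤ Real.exp (Real.log p * #Js) := by
    rw [Real.exp_mul, Real.exp_log hp0, Real.rpow_natCast]
    exact_mod_cast Nat.choose_le_pow p #Js
  have htwo : 2 ≤ Real.exp (Real.log p * #Js) := by
    calc (2 : ℝ) ≤ Real.exp (Real.log p * 1) := by rwa [mul_one, Real.exp_log hp0]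
      _ ≤ _ := by gcongr
  have hexp : Real.exp (-((C + 1) * Real.log p * #Js) + H) ≤
      Real.exp (Real.log p * #Js + Real.log p * #Js + C * (Real.log p * #Js)) := by
    have h8 := (mul_le_mul_of_nonneg_right hlb (Real.exp_pos H).le).trans h
    have h9 : Real.exp (-((C + 1) * Real.log p * #Js)) * Real.exp H ≤
        2 * Real.exp (C * (Real.log p * #Js)) * p.choose #Js := by
      refine le_of_mul_le_mul_left ?_ (show 0 < (p.choose #Js : ℝ)⁻¹ *
        Real.exp (-‖z‖ ^ 2 / (2 * σ ^ 2)) by positivity)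
      calc _ = _ := by ring
        _ ≤ _ := h8
        _ = _ := by field_simp
    rw [Real.exp_add, Real.exp_add, Real.exp_add]
    calc _ ≤ _ := h9
      _ = 2 * p.choose #Js * Real.exp (C * (Real.log p * #Js)) := by ring
      _ ≤ _ := by gcongr
  rw [Real.exp_le_exp] at hexp
  rw [hsum]
  have : H ≤ 3 * (#Js * ((C + 1) * Real.log p)) := by
    nlinarith [mul_nonneg hC (mul_nonneg hL.le (zero_le_one.trans hs))]
  nlinarith [mul_le_mul_of_nonneg_left this (sq_nonneg σ)]

lemma toLp_mulVec_mem_span {n p : ℕ} (X : Matrix (Fin n) (Fin p) ℝ) (J : Finset (Fin p))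
    (b : Fin p → ℝ) (hb : ∀ j ∉ J, b j = 0) :
    WithLp.toLp 2 (X.mulVec b) ∈ Submodule.span ℝ
      ((fun j => (WithLp.toLp 2 fun i => X i j : EuclideanSpace ℝ (Fin n))) '' J) := by
  have h : (WithLp.toLp 2 (X.mulVec b) : EuclideanSpace ℝ (Fin n)) =
      ∑ j ∈ J, b j • (WithLp.toLp 2 fun i => X i j : EuclideanSpace ℝ (Fin n)) := by
    rw [Finset.sum_subset (Finset.subset_univ J) fun j _ hj => by rw [hb j hj, zero_smul]]
    ext i
    simp [Matrix.mulVec, dotProduct, mul_comm]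
  rw [h]
  exact Submodule.sum_mem _ fun j hj =>
    Submodule.smul_mem _ _ (Submodule.subset_span (Set.mem_image_of_mem _ hj))

lemma sum_sq_sub_mulVec_le {n p : ℕ} (X : Matrix (Fin n) (Fin p) ℝ) (J : Finset (Fin p))
    (y : Fin n → ℝ) (a b : Fin p → ℝ) (ha : ∀ j ∉ J, a j = 0) (hb : ∀ j ∉ J, b j = 0)
    (horth : ∀ j ∈ J, ∑ i, (y i - X.mulVec a i) * X i j = 0) :
    ∑ i, (y i - X.mulVec a i) ^ 2 ≤ ∑ i, (y i - X.mulVec b i) ^ 2 := by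
  have hcross : ∑ i, (y i - X.mulVec a i) * X.mulVec (a - b) i = 0 := by
    simp only [Matrix.mulVec, dotProduct, Finset.mul_sum]
    rw [Finset.sum_comm]
    refine Finset.sum_eq_zero fun j _ => ?_
    by_cases hj : j ∈ J
    · have h := congrArg (· * (a - b) j) (horth j hj)
      simpa only [zero_mul, Finset.sum_mul, mul_assoc, Matrix.mulVec, dotProduct] using h
    · simp [ha j hj, hb j hj]
  have hexpand : ∑ i, (y i - X.mulVec b i) ^ 2 = ∑ i, (y i - X.mulVec a i) ^ 2
      + 2 * ∑ i, (y i - X.mulVec a i) * X.mulVec (a - b) i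
      + ∑ i, X.mulVec (a - b) i ^ 2 := by
    rw [Finset.mul_sum, ← Finset.sum_add_distrib, ← Finset.sum_add_distrib]
    refine Finset.sum_congr rfl fun i _ => ?_
    rw [Matrix.mulVec_sub, Pi.sub_apply]
    ring
  rw [hexpand, hcross]
  linarith [Finset.sum_nonneg fun i (_ : i ∈ univ) => sq_nonneg (X.mulVec (a - b) i)]

lemma sum_sq_weighted_mean_sub_le {ι κ : Type*} [Fintype ι] [Fintype κ] (q : ι → ℝ)
    (hq : ∀ a, 0 ≤ q a) (hq1 : ∑ a, q a = 1) (f : ι → κ → ℝ) (m : κ → ℝ) :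
    ∑ i, (∑ a, q a * f a i - m i) ^ 2 ≤ ∑ a, q a * ∑ i, (f a i - m i) ^ 2 := by
  simp_rw [Finset.mul_sum]
  rw [Finset.sum_comm]
  refine Finset.sum_le_sum fun i _ => ?_
  have h := (even_two.convexOn_pow (𝕜 := ℝ)).map_sum_le (t := univ) (w := q)
    (p := fun a => f a i - m i) (fun a _ => hq a) hq1 fun _ _ => Set.mem_univ _
  simp only [smul_eq_mul, mul_sub, Finset.sum_sub_distrib, ← Finset.sum_mul, hq1, one_mul] at h
  simpa only [mul_sub] using h

theorem stmt1
    (n p : ℕ) (hn : 1 ≤ n) (hnp : n ≤ p) (hp2 : 2 ≤ p)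
    (X : Matrix (Fin n) (Fin p) ℝ)
    (hX : ∀ j, Real.sqrt (∑ i, (X i j)^2) = Real.sqrt n)
    (σ : ℝ) (hσ : 0 < σ)
    (βs : Fin p → ℝ) (sstar : ℕ) (hs1 : 1 ≤ sstar)
    (Jstar : Finset (Fin p)) (hJstar : Jstar = Finset.univ.filter (fun j => βs j ≠ 0))
    (hcard : Jstar.card = sstar)
    (P : Finset (Fin p) → (Fin n → ℝ) → (Fin n → ℝ))
    (hP : ∀ (J : Finset (Fin p)) (v : Fin n → ℝ),
        (∃ cf : Fin p → ℝ, (∀ j ∉ J, cf j = 0) ∧ P J v = X.mulVec cf)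
        ∧ ∀ j ∈ J, (∑ i, (v i - P J v i) * X i j) = 0)
    (μ : Measure (Fin n → ℝ))
    (hμ : μ = Measure.pi (fun _ : Fin n => gaussianReal 0 (Real.toNNReal (σ^2))))
    (hminimal : ∀ b : Fin p → ℝ, X.mulVec b = X.mulVec βs →
        sstar ≤ (Finset.univ.filter (fun j => b j ≠ 0)).card)
    (y : (Fin n → ℝ) → Fin n → ℝ)
    (hy : ∀ z i, y z i = X.mulVec βs i + z i)
    (sbar : ℕ) (hsbar1 : sstar ≤ sbar) (hsbar2 : sbar ≤ p)
    (lam : ℝ)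
    (w Post : (Fin n → ℝ) → Finset (Fin p) → ℝ)
    (hw : ∀ z J, w z J = if J.card ≤ sbar then
        ((p.choose J.card : ℝ))⁻¹ * Real.exp (-(lam * (J.card : ℝ)))
          * Real.exp (-(∑ i, (y z i - P J (y z) i)^2) / (2 * σ^2)) else 0)
    (hPost : ∀ z J, Post z J = w z J / ∑ J' : Finset (Fin p), w z J')
    (bh : (Fin n → ℝ) → Finset (Fin p) → Fin p → ℝ)
    (hbh : ∀ z J, (∀ j ∉ J, bh z J j = 0)
        ∧ X.mulVec (bh z J) = P J (y z)
        ∧ ∀ b : Fin p → ℝ, (∀ j ∉ J, b j = 0) → X.mulVec b = P J (y z) →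
            ∑ j, (bh z J j)^2 ≤ ∑ j, (b j)^2)
    (c : ℝ) (hc : 0 < c)
    (hlam : lam = (62 + 12 * c) * Real.log p)
    :
    ENNReal.ofReal (1 - (p : ℝ) ^ (-c)) ≤
      μ {z |
        Real.sqrt (∑ i, ((∑ J : Finset (Fin p), Post z J * X.mulVec (bh z J) i)
            - X.mulVec βs i)^2)
          ≤ σ * Real.sqrt (12 * (sstar : ℝ) * lam)} := by
  set v : Fin p → EuclideanSpace ℝ (Fin n) := fun j => WithLp.toLp 2 fun i => X i j with hv
  have hL : 0 < Real.log p := Real.log_pos (by exact_mod_cast hp2)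
  refine (stdGaussian_projections_le hp2 v hc).trans ?_
  rw [hμ, pi_gaussianReal_zero_eq_map_stdGaussian]
  refine le_trans (measure_mono fun x hx => ?_) (Measure.le_map_apply (by fun_prop) _)
  rw [Set.mem_preimage, Set.mem_ofPred_eq]
  set z : Fin n → ℝ := σ • x.ofLp with hzdef
  have hbh_mul (J) : X.mulVec (bh z J) = P J (y z) := (hbh z J).2.1
  simp_rw [hbh_mul]
  set m : EuclideanSpace ℝ (Fin n) := WithLp.toLp 2 (X.mulVec βs) with hm
  set f : Finset (Fin p) → EuclideanSpace ℝ (Fin n) := fun J => WithLp.toLp 2 (P J (y z)) with hf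
  have hβs : ∀ j ∉ Jstar, βs j = 0 := by simp [hJstar]
  have hJne : Jstar.Nonempty := Finset.card_pos.1 (by omega)
  have hres (J) : ‖m + σ • x - f J‖ ^ 2 = ∑ i, (y z i - P J (y z) i) ^ 2 := by
    rw [EuclideanSpace.real_norm_sq_eq]
    simp [hm, hf, hy, hzdef]
  have herr (J) : ‖f J - m‖ ^ 2 = ∑ i, (P J (y z) i - X.mulVec βs i) ^ 2 := by
    rw [EuclideanSpace.real_norm_sq_eq]
    simp [hm, hf]
  have hfmem (J : Finset (Fin p)) : f J ∈ Submodule.span ℝ (v '' J) := by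
    obtain ⟨cf, hcf, hPc⟩ := (hP J (y z)).1
    simp only [hf, hPc]
    exact toLp_mulVec_mem_span X J cf hcf
  have hbest : ‖m + σ • x - f Jstar‖ ≤ ‖σ • x‖ := by
    refine (sq_le_sq₀ (norm_nonneg _) (norm_nonneg _)).1 ?_
    obtain ⟨⟨cf, hcf, hPc⟩, horth⟩ := hP Jstar (y z)
    rw [hPc] at horth
    rw [hres, hPc]
    refine (sum_sq_sub_mulVec_le X Jstar (y z) cf βs hcf hβs horth).trans_eq ?_
    rw [EuclideanSpace.real_norm_sq_eq]
    simp [hy, hzdef]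
  have hnoise (K : Finset (Fin p)) (hK : K.Nonempty) :
      ‖(Submodule.span ℝ (v '' K)).starProjection (σ • x)‖ ^ 2
        ≤ σ ^ 2 * ((61 + 12 * c) * (Real.log p * #K)) := by
    rw [map_smul, norm_smul, mul_pow, Real.norm_eq_abs, sq_abs]
    exact mul_le_mul_of_nonneg_left (hx K hK) (sq_nonneg σ)
  have hlam' : lam = (61 + 12 * c + 1) * Real.log p := by rw [hlam]; ring
  obtain ⟨hw0, hW, hmain⟩ := posterior_expected_sq_error_le hp2 v Jstar hJne m (σ • x)
    (toLp_mulVec_mem_span X Jstar βs hβs) f hfmem hbest hσ (by positivity) hnoise sbar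
    (hcard ▸ hsbar1) (w z) fun J => by rw [hw, hres, hlam']
  simp_rw [← hPost, herr] at hmain
  have hjensen := sum_sq_weighted_mean_sub_le (Post z)
    (fun J => by rw [hPost]; exact div_nonneg (hw0 J) hW.le)
    (by simp_rw [hPost]; rw [← Finset.sum_div, div_self hW.ne'])
    (fun J => P J (y z)) (X.mulVec βs)
  rw [← hlam', hcard] at hmain
  have hsq := Real.sqrt_le_sqrt (hjensen.trans hmain)
  rwa [Real.sqrt_mul (sq_nonneg σ), Real.sqrt_sq hσ.le] at hsq
end

section
/- Fix ε > 0 and c ≥ 1, assume Condition I((2+ε)s⋆) holds (i.e. ν_{(2+ε)s⋆} > 0), take λ = ((1+ε)/ε)·(23 + 5c)·log p, and assume min_{j ∈ J⋆} |β⋆_j| ≥ 3σ·√(λ/n)/ν_{(2+ε)s⋆}. Then with probability at least 1 − 2p^(−c) over the Gaussian noise z: Π(J⋆) > Π(J) for every J ≠ J⋆, and moreover Π(J⋆) ≥ 1 − 4·p^(−c). -/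
open MeasureTheory ProbabilityTheory Finset
open scoped Classical ENNReal

section Gaussian

lemma exp_quarter_sq_mul_gaussianPDFReal (x : ℝ) :
    gaussianPDFReal 0 1 x * Real.exp (1 / 4 * x ^ 2) =
      (Real.sqrt (2 * Real.pi))⁻¹ * Real.exp (-(1 / 4) * x ^ 2) := by
  simp only [gaussianPDFReal, NNReal.coe_one, mul_one, sub_zero]
  rw [mul_assoc, ← Real.exp_add]
  ring_nf

lemma integrable_exp_quarter_sq_gaussianReal :
    Integrable (fun x : ℝ => Real.exp (1 / 4 * x ^ 2)) (gaussianReal 0 1) := by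
  rw [gaussianReal_of_var_ne_zero 0 one_ne_zero]
  unfold gaussianPDF
  rw [integrable_withDensity_iff_integrable_smul₀' (by fun_prop) (by simp)]
  simp only [smul_eq_mul]
  have : (fun x : ℝ => (ENNReal.ofReal (gaussianPDFReal 0 1 x)).toReal *
      Real.exp (1 / 4 * x ^ 2)) =
      fun x => (Real.sqrt (2 * Real.pi))⁻¹ * Real.exp (-(1 / 4) * x ^ 2) := by
    ext x
    rw [ENNReal.toReal_ofReal (gaussianPDFReal_nonneg _ _ _),
      exp_quarter_sq_mul_gaussianPDFReal]
  rw [this]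
  exact (integrable_exp_neg_mul_sq (by norm_num)).const_mul _

lemma integral_exp_quarter_sq_gaussianReal :
    ∫ x : ℝ, Real.exp (1 / 4 * x ^ 2) ∂(gaussianReal 0 1) = Real.sqrt 2 := by
  rw [integral_gaussianReal_eq_integral_smul one_ne_zero]
  simp only [smul_eq_mul]
  simp_rw [exp_quarter_sq_mul_gaussianPDFReal]
  rw [integral_const_mul, integral_gaussian, ← Real.sqrt_inv, ← Real.sqrt_mul (by positivity)]
  congr 1
  field_simp
  norm_num

variable {E : Type*} [NormedAddCommGroup E] [InnerProductSpace ℝ E] [FiniteDimensional ℝ E]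

lemma exp_quarter_norm_sq_sum (x : Fin (Module.finrank ℝ E) → ℝ) :
    Real.exp (1 / 4 * ‖∑ i, x i • stdOrthonormalBasis ℝ E i‖ ^ 2) =
      ∏ i, Real.exp (1 / 4 * x i ^ 2) := by
  rw [← Real.exp_sum, ← Finset.mul_sum]
  congr 2
  rw [← real_inner_self_eq_norm_sq, (stdOrthonormalBasis ℝ E).orthonormal.inner_sum]
  simp [sq]

variable [MeasurableSpace E] [BorelSpace E]

lemma integrable_exp_quarter_norm_sq_stdGaussian :
    Integrable (fun x : E => Real.exp (1 / 4 * ‖x‖ ^ 2)) (stdGaussian E) := by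
  rw [stdGaussian, integrable_map_measure
    (Measurable.aestronglyMeasurable (by fun_prop)) (Measurable.aemeasurable (by fun_prop))]
  simp only [Function.comp_def, exp_quarter_norm_sq_sum]
  exact Integrable.fintype_prod (f := fun _ (t : ℝ) => Real.exp (1 / 4 * t ^ 2))
    fun _ => integrable_exp_quarter_sq_gaussianReal

lemma integral_exp_quarter_norm_sq_stdGaussian :
    ∫ x : E, Real.exp (1 / 4 * ‖x‖ ^ 2) ∂(stdGaussian E) =
      Real.sqrt 2 ^ (Module.finrank ℝ E) := by
  rw [stdGaussian, integral_map (Measurable.aemeasurable (by fun_prop))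
    (Measurable.aestronglyMeasurable (by fun_prop))]
  simp only [exp_quarter_norm_sq_sum]
  rw [integral_fintype_prod_eq_prod (f := fun _ (t : ℝ) => Real.exp (1 / 4 * t ^ 2))]
  simp [integral_exp_quarter_sq_gaussianReal, -one_div]

lemma stdGaussian_map_orthogonalProjectionOnto (W : Submodule ℝ E) :
    (stdGaussian E).map W.orthogonalProjectionOnto = stdGaussian W := by
  apply Measure.ext_of_charFun
  ext t
  rw [charFun_stdGaussian, charFun_apply, integral_map (Measurable.aemeasurable (by fun_prop))
    (Measurable.aestronglyMeasurable (by fun_prop))]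
  have h := charFun_stdGaussian (E := E) (t : E)
  rw [charFun_apply] at h
  simpa using h

/-- Chernoff bound for the squared norm of the projection of a standard Gaussian vector. -/
lemma stdGaussian_norm_sq_starProjection_ge_le (W : Submodule ℝ E) (d : ℕ)
    (hd : Module.finrank ℝ W ≤ d) (x : ℝ) :
    (stdGaussian E).real {g | 4 * x + 2 * d * Real.log 2 ≤ ‖W.starProjection g‖ ^ 2} ≤
      Real.exp (-x) := by
  have h1 : (stdGaussian E).real {g | 4 * x + 2 * d * Real.log 2 ≤ ‖W.starProjection g‖ ^ 2} =
      (stdGaussian W).real {u | 4 * x + 2 * d * Real.log 2 ≤ ‖u‖ ^ 2} := by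
    rw [← stdGaussian_map_orthogonalProjectionOnto W, map_measureReal_apply (by fun_prop)
      (measurableSet_le (by fun_prop) (by fun_prop))]
    rfl
  rw [h1]
  refine (measure_ge_le_exp_mul_mgf (X := fun u : W => ‖u‖ ^ 2) _ (t := 1 / 4) (by norm_num)
    integrable_exp_quarter_norm_sq_stdGaussian).trans ?_
  rw [mgf, integral_exp_quarter_norm_sq_stdGaussian]
  have h2 : Real.sqrt 2 ^ Module.finrank ℝ W ≤ Real.exp (d / 2 * Real.log 2) := by
    calc Real.sqrt 2 ^ Module.finrank ℝ W ≤ Real.sqrt 2 ^ d :=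
          pow_le_pow_right₀ (Real.one_le_sqrt.2 (by norm_num)) hd
      _ = Real.exp (d / 2 * Real.log 2) := by
          rw [Real.sqrt_eq_rpow, ← Real.rpow_natCast, ← Real.rpow_mul (by norm_num),
            Real.rpow_def_of_pos (by norm_num)]
          ring_nf
  calc _ ≤ Real.exp (-(1 / 4) * (4 * x + 2 * d * Real.log 2)) * Real.exp (d / 2 * Real.log 2) := by
        gcongr
    _ = Real.exp (-x) := by rw [← Real.exp_add]; ring_nf

lemma stdGaussian_map_inner (b : E) :
    (stdGaussian E).map (fun g => inner ℝ b g) = gaussianReal 0 (Real.toNNReal (‖b‖ ^ 2)) := by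
  have h := IsGaussian.map_eq_gaussianReal (μ := stdGaussian E) (innerSL ℝ b)
  rw [integral_strongDual_stdGaussian, variance_dual_stdGaussian, innerSL_apply_norm] at h
  exact h

/-- Chernoff bound for a linear functional of a standard Gaussian vector. -/
lemma stdGaussian_neg_inner_ge_le (b : E) (T : ℝ) :
    (stdGaussian E).real {g | ‖b‖ ^ 2 / 4 + 2 * T ≤ -inner ℝ b g} ≤ Real.exp (-T) := by
  have h0 : (stdGaussian E).map (fun g => inner ℝ (-b) g) =
      gaussianReal 0 (Real.toNNReal (‖b‖ ^ 2)) := by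
    rw [stdGaussian_map_inner, norm_neg]
  have hint : Integrable (fun g => Real.exp (1 / 2 * inner ℝ (-b) g)) (stdGaussian E) := by
    have := integrable_exp_mul_gaussianReal (μ := 0) (v := Real.toNNReal (‖b‖ ^ 2)) (1 / 2)
    rw [← h0, integrable_map_measure (Measurable.aestronglyMeasurable (by fun_prop))
      (Measurable.aemeasurable (by fun_prop))] at this
    exact this
  have h := measure_ge_le_exp_mul_mgf (X := fun g : E => inner ℝ (-b) g) (‖b‖ ^ 2 / 4 + 2 * T)
    (t := 1 / 2) (by norm_num) hint
  rw [mgf_gaussianReal h0, Real.coe_toNNReal _ (by positivity), ← Real.exp_add] at h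
  simp only [inner_neg_left] at h
  refine h.trans_eq ?_
  ring_nf

end Gaussian

section Projection

variable {E : Type*} [NormedAddCommGroup E] [InnerProductSpace ℝ E] [FiniteDimensional ℝ E]

lemma norm_sq_sub_starProjection (U : Submodule ℝ E) (v : E) :
    ‖v - U.starProjection v‖ ^ 2 = ‖v‖ ^ 2 - ‖U.starProjection v‖ ^ 2 := by
  have h := U.norm_sq_eq_add_norm_sq_starProjection v
  rw [U.starProjection_orthogonal_val] at h
  linarith

lemma norm_sq_starProjection_add_inf_orthogonal {V K : Submodule ℝ E} (hVK : V ≤ K) (v : E) :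
    ‖K.starProjection v‖ ^ 2 =
      ‖V.starProjection v‖ ^ 2 + ‖(Vᗮ ⊓ K).starProjection v‖ ^ 2 := by
  have hmem : K.starProjection v - V.starProjection v ∈ Vᗮ ⊓ K := by
    refine ⟨?_, K.sub_mem (K.starProjection_apply_mem v) (hVK (V.starProjection_apply_mem v))⟩
    have h1 := K.sub_starProjection_mem_orthogonal v
    have h2 := V.sub_starProjection_mem_orthogonal v
    have h3 := Vᗮ.sub_mem h2 (Submodule.orthogonal_le hVK h1)
    simpa using h3
  have heq : K.starProjection v - V.starProjection v = (Vᗮ ⊓ K).starProjection v := by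
    refine (Submodule.eq_starProjection_of_mem_orthogonal hmem ?_).symm
    have h1 : v - K.starProjection v ∈ (Vᗮ ⊓ K)ᗮ :=
      Submodule.orthogonal_le inf_le_right (K.sub_starProjection_mem_orthogonal v)
    have h2 : V.starProjection v ∈ (Vᗮ ⊓ K)ᗮ :=
      Submodule.orthogonal_le inf_le_left
        (V.le_orthogonal_orthogonal (V.starProjection_apply_mem v))
    have h3 := (Vᗮ ⊓ K)ᗮ.add_mem h1 h2
    convert h3 using 1
    abel
  rw [← heq, add_comm, ← sub_add_cancel (K.starProjection v) (V.starProjection v),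
    add_sub_cancel_right]
  simp only [sq]
  rw [norm_add_sq_eq_norm_sq_add_norm_sq_real]
  rw [real_inner_comm]
  exact hmem.1 _ (V.starProjection_apply_mem v)

lemma norm_starProjection_le_of_le {U K : Submodule ℝ E} (hUK : U ≤ K) (v : E) :
    ‖U.starProjection v‖ ^ 2 ≤ ‖K.starProjection v‖ ^ 2 := by
  rw [norm_sq_starProjection_add_inf_orthogonal hUK]
  exact le_add_of_nonneg_right (by positivity)

lemma sub_starProjection_add_of_mem {V : Submodule ℝ E} {m : E} (hm : m ∈ V) (g : E) :
    m + g - V.starProjection (m + g) = g - V.starProjection g := by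
  rw [map_add, Submodule.starProjection_eq_self_iff.2 hm]
  abel

/-- Lower bound on the excess residual of a model `U` over the model `V` of the signal,
ignoring the signal missed by `U`. -/
lemma residual_diff_ge_neg {U V K : Submodule ℝ E} (hU : U ≤ K) (hV : V ≤ K) {m : E}
    (hm : m ∈ V) (g : E) :
    -‖(Vᗮ ⊓ K).starProjection g‖ ^ 2 ≤
      ‖m + g - U.starProjection (m + g)‖ ^ 2 - ‖m + g - V.starProjection (m + g)‖ ^ 2 := by
  have h1 : ‖m + g - K.starProjection (m + g)‖ ^ 2 ≤ ‖m + g - U.starProjection (m + g)‖ ^ 2 := by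
    rw [norm_sq_sub_starProjection, norm_sq_sub_starProjection]
    linarith [norm_starProjection_le_of_le hU (m + g)]
  rw [sub_starProjection_add_of_mem (hV hm), norm_sq_sub_starProjection,
    norm_sq_starProjection_add_inf_orthogonal hV] at h1
  rw [sub_starProjection_add_of_mem hm, norm_sq_sub_starProjection V g]
  linarith

/-- Lower bound on the excess residual of a model `U` over the model `V` of the signal. -/
lemma residual_diff_ge {U V K : Submodule ℝ E} (hU : U ≤ K) (hV : V ≤ K) {m : E}
    (hm : m ∈ V) (g : E) :
    ‖m - U.starProjection m‖ ^ 2 + 2 * inner ℝ (m - U.starProjection m) g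
        - ‖(Vᗮ ⊓ K).starProjection g‖ ^ 2 ≤
      ‖m + g - U.starProjection (m + g)‖ ^ 2 - ‖m + g - V.starProjection (m + g)‖ ^ 2 := by
  have h0 : m + g - U.starProjection (m + g) =
      (m - U.starProjection m) + (g - U.starProjection g) := by
    rw [map_add]; abel
  have h1 : inner ℝ (m - U.starProjection m) (U.starProjection g) = 0 :=
    U.starProjection_inner_eq_zero _ _ (U.starProjection_apply_mem g)
  rw [h0, norm_add_sq_real, inner_sub_right, h1, sub_starProjection_add_of_mem hm,
    norm_sq_sub_starProjection U g, norm_sq_sub_starProjection V g]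
  have h2 := norm_starProjection_le_of_le hU g
  rw [norm_sq_starProjection_add_inf_orthogonal hV] at h2
  linarith

end Projection

section Counting

lemma choose_succ_le_mul_choose (p m : ℕ) : p.choose (m + 1) ≤ p * p.choose m := by
  have h := Nat.choose_succ_right_eq p m
  calc p.choose (m + 1) ≤ p.choose (m + 1) * (m + 1) := Nat.le_mul_of_pos_right _ (by omega)
    _ = p.choose m * (p - m) := h
    _ ≤ p.choose m * p := Nat.mul_le_mul_left _ (Nat.sub_le _ _)
    _ = _ := mul_comm _ _

lemma choose_le_mul_choose_succ {p m : ℕ} (hm : m + 1 ≤ p) :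
    p.choose m ≤ p * p.choose (m + 1) := by
  have h := Nat.choose_succ_right_eq p m
  calc p.choose m ≤ p.choose m * (p - m) := Nat.le_mul_of_pos_right _ (by omega)
    _ = p.choose (m + 1) * (m + 1) := h.symm
    _ ≤ p.choose (m + 1) * p := Nat.mul_le_mul_left _ hm
    _ = _ := mul_comm _ _

lemma choose_add_le_pow_mul_choose (p m d : ℕ) : p.choose (m + d) ≤ p ^ d * p.choose m := by
  induction d with
  | zero => simp
  | succ d ih =>
    calc p.choose (m + d + 1) ≤ p * p.choose (m + d) := choose_succ_le_mul_choose _ _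
      _ ≤ p * (p ^ d * p.choose m) := Nat.mul_le_mul_left _ ih
      _ = _ := by ring

lemma choose_le_pow_mul_choose_add {p m d : ℕ} (h : m + d ≤ p) :
    p.choose m ≤ p ^ d * p.choose (m + d) := by
  induction d with
  | zero => simp
  | succ d ih =>
    calc p.choose m ≤ p ^ d * p.choose (m + d) := ih (by omega)
      _ ≤ p ^ d * (p * p.choose (m + d + 1)) :=
        Nat.mul_le_mul_left _ (choose_le_mul_choose_succ (by omega))
      _ = _ := by rw [← add_assoc m d 1]; ring

lemma choose_card_le_pow_mul_choose_card {p : ℕ} (hp : 1 ≤ p) (J K : Finset (Fin p)) :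
    p.choose K.card ≤ p ^ ((K \ J).card + (J \ K).card) * p.choose J.card := by
  have h := Finset.card_sdiff_add_card_inter J K
  have h' := Finset.card_sdiff_add_card_inter K J
  rw [Finset.inter_comm] at h'
  have hJ : J.card ≤ p := by simpa using J.card_le_univ
  rcases le_total K.card J.card with hle | hle
  · obtain ⟨d, hd⟩ := Nat.exists_eq_add_of_le hle
    rw [hd]
    refine (choose_le_pow_mul_choose_add (d := d) (by omega)).trans ?_
    gcongr
    omega
  · obtain ⟨d, hd⟩ := Nat.exists_eq_add_of_le hle
    rw [hd]
    refine (choose_add_le_pow_mul_choose p J.card d).trans ?_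
    gcongr
    omega

lemma sum_pow_card_ne_empty_le {p : ℕ} {x : ℝ} (hx : 0 ≤ x) (hpx : p * x ≤ 1) :
    ∑ D ∈ (Finset.univ : Finset (Finset (Fin p))).erase ∅, x ^ D.card ≤ 2 * (p * x) := by
  have h1 : ∑ D : Finset (Fin p), x ^ D.card = (x + 1) ^ p := by
    have := Fintype.sum_pow_mul_eq_add_pow (Fin p) x 1
    simpa using this
  rw [← Finset.add_sum_erase _ _ (Finset.mem_univ (∅ : Finset (Fin p)))] at h1
  have h2 : (x + 1) ^ p ≤ Real.exp (p * x) := by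
    rw [Real.exp_nat_mul]
    exact pow_le_pow_left₀ (by linarith) (Real.add_one_le_exp x) p
  have h0 : 0 ≤ p * x := by positivity
  have h3 := abs_le.1 (Real.abs_exp_sub_one_sub_id_le (x := p * x) (by rwa [abs_of_nonneg h0]))
  simp only [Finset.card_empty, pow_zero] at h1
  nlinarith [h3.2]

lemma sum_pow_card_symmDiff_ne_le {p : ℕ} (K : Finset (Fin p)) {x : ℝ} (hx : 0 ≤ x)
    (hpx : p * x ≤ 1) :
    ∑ J ∈ (Finset.univ : Finset (Finset (Fin p))).erase K, x ^ ((K \ J).card + (J \ K).card) ≤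
      2 * (p * x) := by
  refine (Finset.sum_nbij' (fun J => symmDiff K J) (fun D => symmDiff K D) ?_ ?_ ?_ ?_ ?_).trans_le
    (sum_pow_card_ne_empty_le hx hpx)
  · intro J hJ
    have : J ≠ K := by simpa using hJ
    simpa [← Finset.bot_eq_empty, symmDiff_eq_bot] using this.symm
  · intro D hD
    simpa [← Finset.bot_eq_empty] using hD
  · intro J _
    simp
  · intro D _
    simp
  · intro J _
    rw [symmDiff_def, Finset.sup_eq_union, Finset.card_union_of_disjoint disjoint_sdiff_sdiff]

end Counting

section Exponent

/-- The exponent of the weight ratio when the number `l` of superfluous covariates dominates the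
number `k` of missed ones. -/
lemma exponent_le_of_mul_le {ε c A lam k l N R : ℝ} (hε : 0 < ε) (hc : 1 ≤ c) (hA : 0 ≤ A)
    (hlam : lam = ((1 + ε) / ε) * (23 + 5 * c) * A) (hk : 0 ≤ k) (hkl : (1 + ε) * k ≤ l)
    (hN : N ≤ 4 * ((2 + c) * A * l) + 2 * l * A) (hR : -N ≤ R) :
    (k + l) * A - lam * (l - k) - R / 2 ≤ -((1 + c) * A * (k + l)) := by
  have h1 : (23 + 5 * c) * A * l ≤ lam * (l - k) := by
    have : lam * (l - k) - (23 + 5 * c) * A * l =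
        (23 + 5 * c) * A * (l - (1 + ε) * k) / ε := by
      rw [hlam]; field_simp; ring
    have h2 : 0 ≤ (23 + 5 * c) * A * (l - (1 + ε) * k) / ε :=
      div_nonneg (mul_nonneg (by positivity) (by linarith)) hε.le
    linarith
  have hkl' : k ≤ l := by nlinarith
  have h3 : A * k ≤ A * l := by gcongr
  have h4 : c * (A * k) ≤ c * (A * l) := by gcongr
  have h5 : 0 ≤ A * l := mul_nonneg hA (hk.trans hkl')
  have h6 : 0 ≤ c * (A * l) := by positivity
  nlinarith

/-- The exponent of the weight ratio when the missed signal is visible. -/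
lemma exponent_le_of_signal {ε c A lam k l N R B I : ℝ} (hε : 0 < ε) (hc : 1 ≤ c) (hA : 0 ≤ A)
    (hlam : lam = ((1 + ε) / ε) * (23 + 5 * c) * A) (hk : 0 ≤ k) (hl : 0 ≤ l)
    (hN : N ≤ 4 * ((2 + c) * A * l) + 2 * l * A) (hB : 9 * k * lam ≤ B)
    (hI : -I ≤ B / 4 + 2 * ((2 + c) * A * (k + l))) (hR : B + 2 * I - N ≤ R) :
    (k + l) * A - lam * (l - k) - R / 2 ≤ -((1 + c) * A * (k + l)) := by
  have h1 : (23 + 5 * c) * A ≤ lam := by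
    have : lam - (23 + 5 * c) * A = (23 + 5 * c) * A / ε := by
      rw [hlam]; field_simp; ring
    have h2 : 0 ≤ (23 + 5 * c) * A / ε := by positivity
    linarith
  have h2 : (23 + 5 * c) * A * k ≤ lam * k := by gcongr
  have h3 : (23 + 5 * c) * A * l ≤ lam * l := by gcongr
  have h4 : 0 ≤ A * l := by positivity
  have h5 : 0 ≤ c * (A * l) := by positivity
  have h6 : 0 ≤ A * k := by positivity
  have h7 : 0 ≤ c * (A * k) := by positivity
  nlinarith

lemma weight_le_of_exponent_le {p : ℕ} (hp : 1 ≤ p) {c lam RJ RK : ℝ} (J K : Finset (Fin p))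
    (hexp : (((K \ J).card + (J \ K).card : ℕ) : ℝ) * Real.log p -
        lam * ((J \ K).card - (K \ J).card) - (RJ - RK) / 2 ≤
      -((1 + c) * Real.log p * ((K \ J).card + (J \ K).card : ℕ))) :
    ((p.choose J.card : ℝ))⁻¹ * Real.exp (-(lam * (J.card : ℝ))) * Real.exp (-(RJ / 2)) ≤
      ((p : ℝ) ^ (-(1 + c))) ^ ((K \ J).card + (J \ K).card) *
        (((p.choose K.card : ℝ))⁻¹ * Real.exp (-(lam * (K.card : ℝ))) * Real.exp (-(RK / 2))) := by
  have hp0 : (0 : ℝ) < p := by exact_mod_cast hp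
  have hchoose (J : Finset (Fin p)) : (0 : ℝ) < p.choose J.card := by
    exact_mod_cast Nat.choose_pos (by simpa using J.card_le_univ)
  have hcardJ := Finset.card_sdiff_add_card_inter J K
  have hcardK := Finset.card_sdiff_add_card_inter K J
  rw [Finset.inter_comm] at hcardK
  have hcard : (J.card : ℝ) - K.card = (J \ K).card - (K \ J).card := by
    rw [← hcardJ, ← hcardK]
    push_cast
    ring
  rw [← hcard] at hexp
  have hbinom : ((p.choose J.card : ℝ))⁻¹ ≤
      p ^ ((K \ J).card + (J \ K).card) * ((p.choose K.card : ℝ))⁻¹ := by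
    have h1 : (p.choose K.card : ℝ) ≤
        p ^ ((K \ J).card + (J \ K).card) * p.choose J.card := by
      exact_mod_cast choose_card_le_pow_mul_choose_card hp J K
    rw [← div_eq_mul_inv, le_div_iff₀ (hchoose K), ← div_eq_inv_mul, div_le_iff₀ (hchoose J)]
    exact h1
  generalize (K \ J).card + (J \ K).card = d at hexp hbinom ⊢
  have hpd : (p : ℝ) ^ d = Real.exp (d * Real.log p) := by
    rw [Real.exp_nat_mul, Real.exp_log hp0]
  have hpow : ((p : ℝ) ^ (-(1 + c))) ^ d = Real.exp (-((1 + c) * Real.log p * d)) := by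
    rw [Real.rpow_def_of_pos hp0, ← Real.exp_nat_mul]
    congr 1
    ring
  rw [hpd] at hbinom
  have hinv : 0 ≤ ((p.choose K.card : ℝ))⁻¹ := by positivity
  calc _ ≤ Real.exp (d * Real.log p) * ((p.choose K.card : ℝ))⁻¹ *
        Real.exp (-(lam * (J.card : ℝ))) * Real.exp (-(RJ / 2)) := by
        gcongr
    _ = ((p.choose K.card : ℝ))⁻¹ *
        Real.exp (d * Real.log p + -(lam * J.card) + -(RJ / 2)) := by
        rw [Real.exp_add, Real.exp_add]
        ring
    _ ≤ ((p.choose K.card : ℝ))⁻¹ *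
        Real.exp (-((1 + c) * Real.log p * d) + -(lam * K.card) + -(RK / 2)) := by
        refine mul_le_mul_of_nonneg_left (Real.exp_le_exp.2 ?_) hinv
        linarith
    _ = _ := by
        rw [hpow, Real.exp_add, Real.exp_add]
        ring

end Exponent

section Design

variable {n p : ℕ}

/-- The column `j` of a matrix as a Euclidean vector. -/
noncomputable def colVec (X : Matrix (Fin n) (Fin p) ℝ) (j : Fin p) :
    EuclideanSpace ℝ (Fin n) := WithLp.toLp 2 (fun i => X i j)

/-- The span of the columns indexed by `J`. -/
noncomputable def colSpan (X : Matrix (Fin n) (Fin p) ℝ) (J : Finset (Fin p)) :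
    Submodule ℝ (EuclideanSpace ℝ (Fin n)) :=
  Submodule.span ℝ (colVec X '' J)

lemma colSpan_mono (X : Matrix (Fin n) (Fin p) ℝ) {J K : Finset (Fin p)} (h : J ⊆ K) :
    colSpan X J ≤ colSpan X K :=
  Submodule.span_mono (Set.image_mono (by exact_mod_cast h))

lemma toLp_mulVec_mem_colSpan (X : Matrix (Fin n) (Fin p) ℝ) {J : Finset (Fin p)}
    {cf : Fin p → ℝ} (h : ∀ j ∉ J, cf j = 0) :
    WithLp.toLp 2 (X.mulVec cf) ∈ colSpan X J := by
  have : WithLp.toLp 2 (X.mulVec cf) = ∑ j, cf j • colVec X j := by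
    ext i
    simp [Matrix.mulVec, dotProduct, colVec, mul_comm]
  rw [this]
  refine Submodule.sum_mem _ fun j _ => ?_
  by_cases hj : j ∈ J
  · exact Submodule.smul_mem _ _ (Submodule.subset_span ⟨j, by exact_mod_cast hj, rfl⟩)
  · simp [h j hj]

lemma finrank_orthogonal_inf_colSpan_le (X : Matrix (Fin n) (Fin p) ℝ) (J D : Finset (Fin p)) :
    Module.finrank ℝ ↥((colSpan X J)ᗮ ⊓ colSpan X (J ∪ D)) ≤ D.card := by
  have h1 := Submodule.finrank_add_inf_finrank_orthogonal
    (colSpan_mono X (Finset.subset_union_left (s₁ := J) (s₂ := D)))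
  have h2 : colSpan X (J ∪ D) = colSpan X J ⊔ colSpan X D := by
    simp [colSpan, Set.image_union, Submodule.span_union]
  have h3 := Submodule.finrank_add_le_finrank_add_finrank (colSpan X J) (colSpan X D)
  rw [← h2] at h3
  have h4 : Module.finrank ℝ (colSpan X D) ≤ D.card := by
    have := finrank_span_finset_le_card (R := ℝ) (D.image (colVec X))
    rw [Finset.coe_image] at this
    exact this.trans Finset.card_image_le
  omega

lemma toLp_eq_starProjection_colSpan (X : Matrix (Fin n) (Fin p) ℝ) (J : Finset (Fin p))
    (v Pv : Fin n → ℝ) (hmem : ∃ cf : Fin p → ℝ, (∀ j ∉ J, cf j = 0) ∧ Pv = X.mulVec cf)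
    (horth : ∀ j ∈ J, (∑ i, (v i - Pv i) * X i j) = 0) :
    (colSpan X J).starProjection (WithLp.toLp 2 v) = WithLp.toLp 2 Pv := by
  refine Submodule.eq_starProjection_of_mem_orthogonal ?_ ?_
  · obtain ⟨cf, hcf, rfl⟩ := hmem
    exact toLp_mulVec_mem_colSpan X hcf
  · rw [colSpan, Submodule.mem_orthogonal']
    intro u hu
    induction hu using Submodule.span_induction with
    | mem x hx =>
      obtain ⟨j, hj, rfl⟩ := hx
      have := horth j (by exact_mod_cast hj)
      simpa [colVec, PiLp.inner_apply, mul_comm] using this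
    | zero => simp
    | add x y _ _ hx hy => rw [inner_add_right, hx, hy, add_zero]
    | smul a x _ hx => rw [inner_smul_right, hx, mul_zero]

lemma sq_mul_sum_sq_le_of_eq_sInf (hn : 1 ≤ n) (X : Matrix (Fin n) (Fin p) ℝ) {s r : ℝ}
    (hr : r = sInf {r : ℝ | ∃ (J : Finset (Fin p)) (u : Fin p → ℝ),
        (J.card : ℝ) ≤ s ∧ (∀ j ∉ J, u j = 0) ∧ (∑ j, (u j)^2) = 1 ∧
        r = Real.sqrt (∑ i, (X.mulVec u i)^2) / Real.sqrt n})
    (hr0 : 0 ≤ r) {K : Finset (Fin p)} (hK : (K.card : ℝ) ≤ s) {u : Fin p → ℝ}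
    (hu : ∀ j ∉ K, u j = 0) :
    r ^ 2 * n * ∑ j, (u j)^2 ≤ ∑ i, (X.mulVec u i)^2 := by
  have hn0 : (0 : ℝ) < n := by exact_mod_cast hn
  have hS0 : 0 ≤ ∑ j, (u j)^2 := Finset.sum_nonneg fun _ _ => sq_nonneg _
  rcases hS0.eq_or_lt with h0 | hpos
  · rw [← h0, mul_zero]
    exact Finset.sum_nonneg fun _ _ => sq_nonneg _
  set S := ∑ j, (u j)^2 with hS
  have hle : r ≤ Real.sqrt (∑ i, (X.mulVec ((Real.sqrt S)⁻¹ • u) i)^2) / Real.sqrt n := by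
    rw [hr]
    refine csInf_le ⟨0, ?_⟩ ⟨K, (Real.sqrt S)⁻¹ • u, hK, ?_, ?_, rfl⟩
    · rintro _ ⟨_, _, _, _, _, rfl⟩
      positivity
    · intro j hj
      simp [hu j hj]
    · simp only [Pi.smul_apply, smul_eq_mul, mul_pow, inv_pow, Real.sq_sqrt hS0]
      rw [← Finset.mul_sum, ← hS, inv_mul_cancel₀ hpos.ne']
  have hsq := pow_le_pow_left₀ hr0 hle 2
  rw [div_pow, Real.sq_sqrt hn0.le,
    Real.sq_sqrt (Finset.sum_nonneg fun _ _ => sq_nonneg _)] at hsq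
  simp only [Matrix.mulVec_smul, Pi.smul_apply, smul_eq_mul, mul_pow, inv_pow,
    Real.sq_sqrt hS0] at hsq
  rw [← Finset.mul_sum, le_div_iff₀ hn0, ← div_eq_inv_mul, le_div_iff₀ hpos] at hsq
  exact hsq

lemma norm_sq_sub_starProjection_colSpan_ge (hn : 1 ≤ n) (X : Matrix (Fin n) (Fin p) ℝ)
    {s r σ lam : ℝ}
    (hr : r = sInf {r : ℝ | ∃ (J : Finset (Fin p)) (u : Fin p → ℝ),
        (J.card : ℝ) ≤ s ∧ (∀ j ∉ J, u j = 0) ∧ (∑ j, (u j)^2) = 1 ∧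
        r = Real.sqrt (∑ i, (X.mulVec u i)^2) / Real.sqrt n})
    (hr0 : 0 < r) (hσ : 0 < σ) (hlam : 0 ≤ lam) {J K : Finset (Fin p)}
    (hcard : ((K ∪ J).card : ℝ) ≤ s) {β : Fin p → ℝ} (hβ : ∀ j ∉ K, β j = 0)
    (hmin : ∀ j ∈ K, 3 * σ * Real.sqrt (lam / n) / r ≤ |β j|) {Pv : Fin n → ℝ}
    (hmem : ∃ cf : Fin p → ℝ, (∀ j ∉ J, cf j = 0) ∧ Pv = X.mulVec cf) :
    9 * (K \ J).card * lam * σ ^ 2 ≤ ‖WithLp.toLp 2 (X.mulVec β) - WithLp.toLp 2 Pv‖ ^ 2 := by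
  obtain ⟨cf, hcf, rfl⟩ := hmem
  have hn0 : (0 : ℝ) < n := by exact_mod_cast hn
  have h1 := sq_mul_sum_sq_le_of_eq_sInf hn X hr hr0.le hcard (u := β - cf) (by
    intro j hj
    rw [Finset.mem_union, not_or] at hj
    simp [hβ j hj.1, hcf j hj.2])
  have h2 : ‖WithLp.toLp 2 (X.mulVec β) - WithLp.toLp 2 (X.mulVec cf)‖ ^ 2 =
      ∑ i, (X.mulVec (β - cf) i)^2 := by
    rw [EuclideanSpace.real_norm_sq_eq]
    simp [Matrix.mulVec_sub]
  rw [h2]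
  refine le_trans ?_ h1
  have h3 : (K \ J).card * (9 * σ ^ 2 * (lam / n) / r ^ 2) ≤ ∑ j, ((β - cf) j) ^ 2 := by
    calc (K \ J).card * (9 * σ ^ 2 * (lam / n) / r ^ 2)
        = ∑ j ∈ K \ J, (9 * σ ^ 2 * (lam / n) / r ^ 2) := by simp
      _ ≤ ∑ j ∈ K \ J, ((β - cf) j) ^ 2 := by
          refine Finset.sum_le_sum fun j hj => ?_
          rw [Finset.mem_sdiff] at hj
          have h4 := pow_le_pow_left₀ (by positivity) (hmin j hj.1) 2
          rw [div_pow, mul_pow, mul_pow, Real.sq_sqrt (by positivity), sq_abs] at h4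
          rw [Pi.sub_apply, hcf j hj.2, sub_zero]
          refine le_trans (le_of_eq ?_) h4
          norm_num
      _ ≤ ∑ j, ((β - cf) j) ^ 2 :=
          Finset.sum_le_sum_of_subset_of_nonneg (Finset.subset_univ _) fun _ _ _ => sq_nonneg _
  calc 9 * (K \ J).card * lam * σ ^ 2
      = r ^ 2 * n * ((K \ J).card * (9 * σ ^ 2 * (lam / n) / r ^ 2)) := by field_simp
    _ ≤ _ := by gcongr

end Design

section Probability

lemma ofReal_one_sub_le_measure_of_forall_notMem {Ω ι κ : Type*} [MeasurableSpace Ω]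
    (ν : Measure Ω) [IsProbabilityMeasure ν] (s : Finset ι) (t : Finset κ)
    (A : ι → Set Ω) (B : κ → Set Ω) {f : ι → ℝ} {h : κ → ℝ}
    (hA : ∀ i ∈ s, ν.real (A i) ≤ f i) (hB : ∀ j ∈ t, ν.real (B j) ≤ h j) {δ : ℝ}
    (hδ : ∑ i ∈ s, f i + ∑ j ∈ t, h j ≤ δ) :
    ENNReal.ofReal (1 - δ) ≤ ν {g | (∀ i ∈ s, g ∉ A i) ∧ ∀ j ∈ t, g ∉ B j} := by
  have h1 := measureReal_biUnion_finset_le (μ := ν) s A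
  have h2 := measureReal_biUnion_finset_le (μ := ν) t B
  have h3 : (Set.univ : Set Ω) ⊆ {g | (∀ i ∈ s, g ∉ A i) ∧ ∀ j ∈ t, g ∉ B j} ∪
      ((⋃ i ∈ s, A i) ∪ ⋃ j ∈ t, B j) := by
    intro g _
    simp only [Set.mem_union, Set.mem_ofPred_eq, Set.mem_iUnion]
    by_cases hg : (∃ i, ∃ (_ : i ∈ s), g ∈ A i) ∨ ∃ j, ∃ (_ : j ∈ t), g ∈ B j
    · exact Or.inr hg
    · push Not at hg
      exact Or.inl hg
  have h4 := measureReal_mono (μ := ν) h3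
  have h5 := measureReal_union_le (μ := ν) {g | (∀ i ∈ s, g ∉ A i) ∧ ∀ j ∈ t, g ∉ B j}
    ((⋃ i ∈ s, A i) ∪ ⋃ j ∈ t, B j)
  have h6 := measureReal_union_le (μ := ν) (⋃ i ∈ s, A i) (⋃ j ∈ t, B j)
  have h7 := Finset.sum_le_sum hA
  have h8 := Finset.sum_le_sum hB
  rw [probReal_univ] at h4
  rw [ENNReal.ofReal_le_iff_le_toReal (measure_ne_top _ _)]
  change _ ≤ ν.real _
  linarith

/-- With high probability, all the noise terms indexed by sets of covariates are small. -/
lemma stdGaussian_good_event_ge {E : Type*} [NormedAddCommGroup E] [InnerProductSpace ℝ E]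
    [FiniteDimensional ℝ E] [MeasurableSpace E] [BorelSpace E] {p : ℕ} (hp : 2 ≤ p) {c : ℝ}
    (hc : 1 ≤ c) (K : Finset (Fin p)) (W : Finset (Fin p) → Submodule ℝ E)
    (hW : ∀ D, Module.finrank ℝ (W D) ≤ D.card) (b : Finset (Fin p) → E) :
    ENNReal.ofReal (1 - 2 * (p : ℝ) ^ (-c)) ≤ stdGaussian E
      {g | (∀ D ∈ (Finset.univ : Finset (Finset (Fin p))).erase ∅,
          g ∉ {g | 4 * ((2 + c) * Real.log p * D.card) + 2 * D.card * Real.log 2 ≤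
            ‖(W D).starProjection g‖ ^ 2}) ∧
        ∀ J ∈ (Finset.univ : Finset (Finset (Fin p))).erase K,
          g ∉ {g | ‖b J‖ ^ 2 / 4 +
              2 * ((2 + c) * Real.log p * ((K \ J).card + (J \ K).card : ℕ)) ≤
            -inner ℝ (b J) g}} := by
  have hp2 : (2 : ℝ) ≤ p := by exact_mod_cast hp
  have hp0 : (0 : ℝ) < p := by linarith
  have hpow (m : ℕ) : ((p : ℝ) ^ (-(2 + c))) ^ m = Real.exp (-((2 + c) * Real.log p * m)) := by
    rw [Real.rpow_def_of_pos hp0, ← Real.exp_nat_mul]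
    congr 1
    ring
  refine ofReal_one_sub_le_measure_of_forall_notMem _ _ _ _ _
    (f := fun D => ((p : ℝ) ^ (-(2 + c))) ^ D.card)
    (h := fun J => ((p : ℝ) ^ (-(2 + c))) ^ ((K \ J).card + (J \ K).card))
    (fun D _ => ?_) (fun J _ => ?_) ?_
  · rw [hpow]
    exact stdGaussian_norm_sq_starProjection_ge_le (W D) D.card (hW D) _
  · rw [hpow]
    exact stdGaussian_neg_inner_ge_le (b J) _
  · have hpx : p * (p * (p : ℝ) ^ (-(2 + c))) = (p : ℝ) ^ (-c) := by
      rw [show -c = 1 + (1 + -(2 + c)) by ring, Real.rpow_add hp0, Real.rpow_add hp0,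
        Real.rpow_one]
    have hle1 : (p : ℝ) ^ (-c) ≤ 1 :=
      Real.rpow_le_one_of_one_le_of_nonpos (by linarith) (by linarith)
    have h0 : 0 ≤ p * (p : ℝ) ^ (-(2 + c)) := by positivity
    have h2 : 2 * (p * (p : ℝ) ^ (-(2 + c))) ≤ (p : ℝ) ^ (-c) := by
      rw [← hpx]
      gcongr
    have h3 := sum_pow_card_ne_empty_le (p := p) (x := (p : ℝ) ^ (-(2 + c)))
      (by positivity) (by linarith)
    have h4 := sum_pow_card_symmDiff_ne_le K (x := (p : ℝ) ^ (-(2 + c)))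
      (by positivity) (by linarith)
    linarith

lemma pi_gaussianReal_eq_map_stdGaussian (n : ℕ) {σ : ℝ} :
    Measure.pi (fun _ : Fin n => gaussianReal 0 (Real.toNNReal (σ^2))) =
      (stdGaussian (EuclideanSpace ℝ (Fin n))).map (fun g i => σ * g i) := by
  have h := Measure.pi_map_pi (μ := fun _ : Fin n => gaussianReal 0 1)
    (f := fun _ (x : ℝ) => σ * x) (fun _ => by fun_prop)
  rw [← map_pi_eq_stdGaussian, Measure.map_map (by fun_prop) (by fun_prop)]
  simp only [gaussianReal_map_const_mul, mul_zero, mul_one] at h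
  have hv : Real.toNNReal (σ^2) = ⟨σ^2, sq_nonneg _⟩ := Real.toNNReal_of_nonneg _
  rw [hv]
  exact h.symm

lemma posterior_of_weight_le {p : ℕ} (hp : 1 ≤ p) {c : ℝ} (hc : 0 ≤ c) (K : Finset (Fin p))
    (w : Finset (Fin p) → ℝ) (hK : 0 < w K) (hw0 : ∀ J, 0 ≤ w J)
    (hw : ∀ J, J ≠ K → w J ≤ ((p : ℝ) ^ (-(1 + c))) ^ ((K \ J).card + (J \ K).card) * w K)
    (hp1 : (p : ℝ) ^ (-(1 + c)) < 1) :
    (∀ J, J ≠ K → w J / ∑ J', w J' < w K / ∑ J', w J') ∧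
      1 - 4 * (p : ℝ) ^ (-c) ≤ w K / ∑ J', w J' := by
  have hp0 : (0 : ℝ) < p := by exact_mod_cast hp
  have hsum : ∑ J', w J' = w K + ∑ J ∈ Finset.univ.erase K, w J :=
    (Finset.add_sum_erase _ _ (Finset.mem_univ K)).symm
  have hrest : 0 ≤ ∑ J ∈ Finset.univ.erase K, w J := Finset.sum_nonneg fun J _ => hw0 J
  have hpos : 0 < ∑ J', w J' := by linarith
  refine ⟨fun J hJ => ?_, ?_⟩
  · refine div_lt_div_of_pos_right ((hw J hJ).trans_lt ?_) hpos
    refine mul_lt_of_lt_one_left hK (pow_lt_one₀ (by positivity) hp1 ?_)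
    intro h0
    obtain ⟨h1, h2⟩ := Nat.add_eq_zero_iff.1 h0
    rw [Finset.card_eq_zero, Finset.sdiff_eq_empty_iff_subset] at h1 h2
    exact hJ (Finset.Subset.antisymm h2 h1)
  · have hpx : p * (p : ℝ) ^ (-(1 + c)) = (p : ℝ) ^ (-c) := by
      rw [show -c = 1 + -(1 + c) by ring, Real.rpow_add hp0, Real.rpow_one]
    have hle1 : (p : ℝ) ^ (-c) ≤ 1 :=
      Real.rpow_le_one_of_one_le_of_nonpos (by exact_mod_cast hp) (by linarith)
    have h1 : ∑ J ∈ Finset.univ.erase K, w J ≤ 2 * (p : ℝ) ^ (-c) * w K := by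
      calc ∑ J ∈ Finset.univ.erase K, w J
          ≤ ∑ J ∈ Finset.univ.erase K,
            ((p : ℝ) ^ (-(1 + c))) ^ ((K \ J).card + (J \ K).card) * w K :=
            Finset.sum_le_sum fun J hJ => hw J (Finset.ne_of_mem_erase hJ)
        _ ≤ 2 * (p : ℝ) ^ (-c) * w K := by
            rw [← Finset.sum_mul, ← hpx]
            gcongr
            exact sum_pow_card_symmDiff_ne_le K (by positivity) (by rw [hpx]; exact hle1)
    have h2 : 0 ≤ (p : ℝ) ^ (-c) := by positivity
    rw [le_div_iff₀ hpos, hsum]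
    nlinarith [mul_nonneg h2 hK.le, mul_nonneg h2 hrest]

end Probability

set_option maxHeartbeats 800000 in
theorem stmt4
    (n p : ℕ) (hn : 1 ≤ n) (hnp : n ≤ p) (hp2 : 2 ≤ p)
    (X : Matrix (Fin n) (Fin p) ℝ)
    (hX : ∀ j, Real.sqrt (∑ i, (X i j)^2) = Real.sqrt n)
    (σ : ℝ) (hσ : 0 < σ)
    (βs : Fin p → ℝ) (sstar : ℕ) (hs1 : 1 ≤ sstar)
    (Jstar : Finset (Fin p)) (hJstar : Jstar = Finset.univ.filter (fun j => βs j ≠ 0))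
    (hcard : Jstar.card = sstar)
    (P : Finset (Fin p) → (Fin n → ℝ) → (Fin n → ℝ))
    (hP : ∀ (J : Finset (Fin p)) (v : Fin n → ℝ),
        (∃ cf : Fin p → ℝ, (∀ j ∉ J, cf j = 0) ∧ P J v = X.mulVec cf)
        ∧ ∀ j ∈ J, (∑ i, (v i - P J v i) * X i j) = 0)
    (μ : Measure (Fin n → ℝ))
    (hμ : μ = Measure.pi (fun _ : Fin n => gaussianReal 0 (Real.toNNReal (σ^2))))
    (hminimal : ∀ b : Fin p → ℝ, X.mulVec b = X.mulVec βs →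
        sstar ≤ (Finset.univ.filter (fun j => b j ≠ 0)).card)
    (y : (Fin n → ℝ) → Fin n → ℝ)
    (hy : ∀ z i, y z i = X.mulVec βs i + z i)
    (sbar : ℕ) (hsbar1 : sstar ≤ sbar) (hsbar2 : sbar ≤ p)
    (lam : ℝ)
    (w Post : (Fin n → ℝ) → Finset (Fin p) → ℝ)
    (hw : ∀ z J, w z J = if J.card ≤ sbar then
        ((p.choose J.card : ℝ))⁻¹ * Real.exp (-(lam * (J.card : ℝ)))
          * Real.exp (-(∑ i, (y z i - P J (y z) i)^2) / (2 * σ^2)) else 0)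
    (hPost : ∀ z J, Post z J = w z J / ∑ J' : Finset (Fin p), w z J')
    (nu : ℝ → ℝ)
    (hnu : ∀ s : ℝ, nu s = sInf {r : ℝ | ∃ (J : Finset (Fin p)) (u : Fin p → ℝ),
        (J.card : ℝ) ≤ s ∧ (∀ j ∉ J, u j = 0) ∧ (∑ j, (u j)^2) = 1 ∧
        r = Real.sqrt (∑ i, (X.mulVec u i)^2) / Real.sqrt n})
    (ε c : ℝ) (hε : 0 < ε) (hc : 1 ≤ c)
    (hI : 0 < nu ((2 + ε) * (sstar : ℝ)))
    (hlam : lam = ((1 + ε) / ε) * (23 + 5 * c) * Real.log p)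
    (hbmin : ∀ j ∈ Jstar,
        3 * σ * Real.sqrt (lam / n) / nu ((2 + ε) * (sstar : ℝ)) ≤ |βs j|)
    :
    ENNReal.ofReal (1 - 2 * (p : ℝ) ^ (-c)) ≤
      μ {z |
        (∀ J : Finset (Fin p), J ≠ Jstar → Post z J < Post z Jstar) ∧
        1 - 4 * (p : ℝ) ^ (-c) ≤ Post z Jstar} := by
  have hp1 : 1 ≤ p := by omega
  have hp0 : (0 : ℝ) < p := by exact_mod_cast hp1
  have hp2' : (2 : ℝ) ≤ p := by exact_mod_cast hp2
  set A := Real.log p with hA_def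
  have hA2 : Real.log 2 ≤ A := Real.log_le_log (by norm_num) hp2'
  have hA : 0 < A := (Real.log_pos (by norm_num)).trans_le hA2
  have hlam0 : 0 ≤ lam := by rw [hlam]; positivity
  have hβ : ∀ j ∉ Jstar, βs j = 0 := fun j hj => by
    rw [hJstar] at hj
    simpa using hj
  set m : EuclideanSpace ℝ (Fin n) := σ⁻¹ • WithLp.toLp 2 (X.mulVec βs) with hm_def
  have hm : m ∈ colSpan X Jstar := Submodule.smul_mem _ _ (toLp_mulVec_mem_colSpan X hβ)
  set b : Finset (Fin p) → EuclideanSpace ℝ (Fin n) :=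
    fun J => m - (colSpan X J).starProjection m with hb_def
  set W : Finset (Fin p) → Submodule ℝ (EuclideanSpace ℝ (Fin n)) :=
    fun D => (colSpan X Jstar)ᗮ ⊓ colSpan X (Jstar ∪ D)
  set dist : Finset (Fin p) → ℕ := fun J => (Jstar \ J).card + (J \ Jstar).card with hdist_def
  have hPJ (J : Finset (Fin p)) (v : Fin n → ℝ) :
      (colSpan X J).starProjection (WithLp.toLp 2 v) = WithLp.toLp 2 (P J v) :=
    toLp_eq_starProjection_colSpan X J v _ (hP J v).1 (hP J v).2
  have hsignal (J : Finset (Fin p)) (hJ : ((Jstar ∪ J).card : ℝ) ≤ (2 + ε) * sstar) :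
      9 * (Jstar \ J).card * lam ≤ ‖b J‖ ^ 2 := by
    have h := norm_sq_sub_starProjection_colSpan_ge hn X (hnu _) hI hσ hlam0 hJ hβ hbmin
      (hP J (X.mulVec βs)).1
    rw [← hPJ] at h
    have hbJ : b J = σ⁻¹ • (WithLp.toLp 2 (X.mulVec βs) -
        (colSpan X J).starProjection (WithLp.toLp 2 (X.mulVec βs))) := by
      simp only [hb_def, hm_def, map_smul, smul_sub]
    rw [hbJ, norm_smul, mul_pow, norm_inv, inv_pow, Real.norm_eq_abs, sq_abs,
      ← div_eq_inv_mul, le_div_iff₀ (by positivity)]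
    exact h
  have hRSS (J : Finset (Fin p)) (g : EuclideanSpace ℝ (Fin n)) :
      -(∑ i, (y (fun i => σ * g i) i - P J (y (fun i => σ * g i)) i)^2) / (2 * σ^2) =
        -(‖m + g - (colSpan X J).starProjection (m + g)‖ ^ 2 / 2) := by
    have hY : WithLp.toLp 2 (y (fun i => σ * g i)) = σ • (m + g) := by
      ext i
      simp [hy, hm_def, hσ.ne']
    have h1 : ∑ i, (y (fun i => σ * g i) i - P J (y (fun i => σ * g i)) i)^2 =
        ‖WithLp.toLp 2 (y (fun i => σ * g i)) -
          (colSpan X J).starProjection (WithLp.toLp 2 (y (fun i => σ * g i)))‖ ^ 2 := by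
      rw [hPJ, EuclideanSpace.real_norm_sq_eq]
      simp
    rw [h1, hY, map_smul, ← smul_sub, norm_smul, mul_pow, Real.norm_eq_abs, sq_abs]
    field_simp
  have hprob := stdGaussian_good_event_ge hp2 hc Jstar W
    (finrank_orthogonal_inf_colSpan_le X Jstar) b
  rw [hμ, pi_gaussianReal_eq_map_stdGaussian]
  refine hprob.trans ((measure_mono ?_).trans
    (Measure.le_map_apply (Measurable.aemeasurable (by fun_prop)) _))
  rintro g ⟨hg1, hg2⟩
  simp only [Set.mem_preimage, Set.mem_ofPred_eq, not_le] at hg1 hg2 ⊢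
  set z : Fin n → ℝ := fun i => σ * g i
  have hstar : Jstar.card ≤ sbar := hcard.trans_le hsbar1
  have hchoose (J : Finset (Fin p)) : (0 : ℝ) < p.choose J.card := by
    exact_mod_cast Nat.choose_pos (by simpa using J.card_le_univ)
  have hwpos : 0 < w z Jstar := by
    rw [hw, if_pos hstar]
    have := hchoose Jstar
    positivity
  have hwnonneg (J : Finset (Fin p)) : 0 ≤ w z J := by
    rw [hw]
    split_ifs <;> positivity
  have hN (J : Finset (Fin p)) : ‖(W (J \ Jstar)).starProjection g‖ ^ 2 ≤
      4 * ((2 + c) * A * (J \ Jstar).card) + 2 * (J \ Jstar).card * A := by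
    by_cases hD : J \ Jstar = ∅
    · have hbot : W (J \ Jstar) = ⊥ := by
        have := finrank_orthogonal_inf_colSpan_le X Jstar (J \ Jstar)
        rw [hD, Finset.card_empty, Nat.le_zero, ← hD] at this
        exact Submodule.finrank_eq_zero.1 this
      have hzero : (W (J \ Jstar)).starProjection g = 0 :=
        (Submodule.eq_bot_iff _).1 hbot _ (Submodule.starProjection_apply_mem _ g)
      rw [hzero, norm_zero, zero_pow two_ne_zero]
      positivity
    · refine (hg1 _ (by simpa using hD)).le.trans ?_
      gcongr
  have hwle (J : Finset (Fin p)) (hJ : J ≠ Jstar) :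
      w z J ≤ ((p : ℝ) ^ (-(1 + c))) ^ dist J * w z Jstar := by
    by_cases hJs : J.card ≤ sbar
    swap
    · rw [hw z J, if_neg hJs]
      positivity
    have hunion : Jstar ∪ J \ Jstar = Jstar ∪ J := Finset.union_sdiff_self_eq_union
    have hexp : ((dist J : ℕ) : ℝ) * A - lam * ((J \ Jstar).card - (Jstar \ J).card) -
        (‖m + g - (colSpan X J).starProjection (m + g)‖ ^ 2 -
          ‖m + g - (colSpan X Jstar).starProjection (m + g)‖ ^ 2) / 2 ≤
        -((1 + c) * A * dist J) := by
      have hUK : colSpan X J ≤ colSpan X (Jstar ∪ J \ Jstar) :=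
        colSpan_mono X (by rw [hunion]; exact Finset.subset_union_right)
      have hVK : colSpan X Jstar ≤ colSpan X (Jstar ∪ J \ Jstar) :=
        colSpan_mono X Finset.subset_union_left
      simp only [hdist_def, Nat.cast_add]
      rcases le_or_gt ((1 + ε) * (Jstar \ J).card) ((J \ Jstar).card : ℝ) with hkl | hkl
      · exact exponent_le_of_mul_le hε hc hA.le hlam (by positivity) hkl (hN J)
          (residual_diff_ge_neg hUK hVK hm g)
      · refine exponent_le_of_signal hε hc hA.le hlam (by positivity) (by positivity) (hN J)
          (hsignal J ?_) (I := inner ℝ (b J) g) ?_ (residual_diff_ge hUK hVK hm g)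
        · have h1 : (Jstar ∪ J).card = Jstar.card + (J \ Jstar).card := by
            rw [← hunion, Finset.card_union_of_disjoint Finset.disjoint_sdiff]
          have h2 : ((Jstar \ J).card : ℝ) ≤ sstar := by
            rw [← hcard]
            exact_mod_cast Finset.card_le_card Finset.sdiff_subset
          rw [h1, hcard]
          push_cast
          nlinarith
        · have := (hg2 J (by simpa using hJ)).le
          simpa only [hdist_def, Nat.cast_add] using this
    rw [hw z J, if_pos hJs, hw z Jstar, if_pos hstar, hRSS, hRSS]
    exact weight_le_of_exponent_le hp1 J Jstar hexp
  have hlt1 : (p : ℝ) ^ (-(1 + c)) < 1 :=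
    Real.rpow_lt_one_of_one_lt_of_neg (by linarith) (by linarith)
  simp only [hPost]
  exact posterior_of_weight_le hp1 (by linarith) Jstar (w z) hwpos hwnonneg hwle hlt1
end
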